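/- arXiv:math/0304272 — 5 statements merged into one kernel-verified Lean document; each statement's English description precedes it below -/
import Mathlib

section
/- Let 3 = p_1 < p_2 < p_3 < … be the increasing sequence of all odd prime numbers. There exists an absolute constant c_3 > 0 with the following property: for every positive integer k, setting δ := 1/(480 k² p_k^6), if N is a positive integer satisfying N/2^k > c_3 k^{1/2} p_k^2 N^{1−δ}, then for every choice of ε_1, …, ε_k ∈ {0, 1} there exists a positive integer n < N such that e_{p_i}(n) ≡ ε_i (mod 2) holds for all i = 1, …, k. -/
/-- For a prime `p`, `e_p(n)` is the exponent of `p` in the factorization of `n!`. -/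
def factorialExp (p n : ℕ) : ℕ := (Nat.factorial n).factorization p

/-- `oddPrime i` is the `(i+1)`-st odd prime, so `oddPrime 0 = 3`, `oddPrime 1 = 5`, …
(i.e. `p_{i+1}` in the enumeration `3 = p₁ < p₂ < …` of all odd primes). -/
noncomputable def oddPrime (i : ℕ) : ℕ := Nat.nth (fun q => q.Prime ∧ Odd q) i

lemma fe_rec {p : ℕ} (hp : p.Prime) (n : ℕ) :
    factorialExp p n = n / p + factorialExp p (n / p) := by
  haveI := Fact.mk hp
  unfold factorialExp
  rw [Nat.factorization_def _ hp, Nat.factorization_def _ hp,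
    ← padicValNat_mul_div_factorial, padicValNat_factorial_mul, add_comm]

/-- sign -/
def sg (p n : ℕ) : ℤ := (-1) ^ factorialExp p n

lemma sg_abs (p n : ℕ) : |sg p n| = 1 := by simp [sg, abs_pow]

lemma sg_zero (p : ℕ) : sg p 0 = 1 := by simp [sg, factorialExp]

lemma sg_lt {p n : ℕ} (hp : p.Prime) (hn : n < p ^ 2) : sg p n = (-1) ^ (n / p) := by
  have h1 := fe_rec hp n
  have h2 := fe_rec hp (n / p)
  have h3 : n / p / p = 0 := by
    rw [Nat.div_div_eq_div_mul, ← pow_two]; exact Nat.div_eq_of_lt hn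
  rw [h3] at h2
  have h4 : factorialExp p 0 = 0 := by simp [factorialExp]
  unfold sg
  rw [h1, h2, h4]; simp

lemma sg_rec {p : ℕ} (hp : p.Prime) (ho : Odd p) (n : ℕ) :
    sg p n = sg p (n % p ^ 2) * sg p (n / p ^ 2) := by
  have hpos := hp.pos
  have h1 := fe_rec hp n
  have h2 := fe_rec hp (n / p)
  have h3 : n / p / p = n / p ^ 2 := by rw [Nat.div_div_eq_div_mul, ← pow_two]
  rw [h3] at h2
  have h5 : n / p = (n % p ^ 2) / p + p * (n / p ^ 2) := by
    conv_lhs => rw [← Nat.mod_add_div n (p ^ 2)]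
    rw [show n % p ^ 2 + p ^ 2 * (n / p ^ 2) = n % p ^ 2 + p * (p * (n / p ^ 2)) by ring]
    rw [Nat.add_mul_div_left _ _ hpos]
  rw [sg_lt hp (Nat.mod_lt _ (by positivity))]
  unfold sg
  rw [h1, h2, h5, ← pow_add]
  obtain ⟨c, hc⟩ := ho
  rw [neg_one_pow_congr]
  generalize n / p ^ 2 = y
  generalize n % p ^ 2 / p = x
  generalize factorialExp p y = z
  rw [hc]
  rw [show x + (2*c+1) * y + (y + z) = (x + z) + 2 * (c*y+y) by ring]
  simp [Nat.even_add]

lemma sg_add {p : ℕ} (hp : p.Prime) (ho : Odd p) (t : ℕ) : ∀ x y, x < (p ^ 2) ^ t →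
    sg p (x + (p ^ 2) ^ t * y) = sg p x * sg p y := by
  induction t with
  | zero => intro x y hx; simp at hx; subst hx; simp [sg_zero]
  | succ t ih =>
    intro x y hx
    have hq : 0 < p ^ 2 := by have := hp.pos; positivity
    rw [sg_rec hp ho (x + _), sg_rec hp ho x]
    have e : x + (p ^ 2) ^ (t+1) * y = x + p ^ 2 * ((p ^ 2) ^ t * y) := by ring
    rw [e, Nat.add_mul_mod_self_left, Nat.add_mul_div_left _ _ hq, ih, mul_assoc]
    rw [Nat.div_lt_iff_lt_mul hq]; rw [pow_succ] at hx; exact hx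

lemma sg_flip {p : ℕ} (hp : p.Prime) (h3 : 3 ≤ p) :
    (p - 1) + 1 < p ^ 2 ∧ sg p 0 * sg p (p - 1) + (sg p 1 * sg p (p - 1 + 1)) = 0 := by
  have h : p < p ^ 2 := by nlinarith
  refine ⟨by omega, ?_⟩
  rw [sg_lt hp (by omega), sg_lt hp (by omega), sg_lt hp (by omega), sg_lt hp (by omega)]
  rw [Nat.div_eq_of_lt (show p - 1 < p by omega), Nat.div_eq_of_lt (show 1 < p by omega),
    show p - 1 + 1 = p by omega, Nat.div_self (by omega)]
  simp

lemma sum_range_split (q n : ℕ) (F : ℕ → ℤ) :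
    ∑ x ∈ Finset.range (n * q), F x
      = ∑ a ∈ Finset.range q, ∑ b ∈ Finset.range n, F (a + q * b) := by
  rw [Finset.sum_comm]
  induction n with
  | zero => simp
  | succ n ih =>
    rw [Finset.sum_range_succ, ← ih, Nat.succ_mul, Finset.sum_range_add]
    congr 1
    exact Finset.sum_congr rfl fun a _ => by rw [add_comm, mul_comm]

/-- correlation -/
def FF (g : ℕ → ℤ) (q m r s : ℕ) : ℤ := ∑ a ∈ Finset.range (q ^ m), g (a + r) * g (a + s)

lemma FF_rec (g : ℕ → ℤ) (q m : ℕ) (hq : 0 < q) (hg : ∀ n, g n = g (n % q) * g (n / q))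
    (r s r1 s1 : ℕ) : FF g q (m + 1) (r + q * r1) (s + q * s1)
      = ∑ a ∈ Finset.range q, g ((a + r) % q) * g ((a + s) % q) *
          FF g q m ((a + r) / q + r1) ((a + s) / q + s1) := by
  unfold FF
  rw [pow_succ, sum_range_split]
  refine Finset.sum_congr rfl fun a _ => ?_
  rw [Finset.mul_sum]
  refine Finset.sum_congr rfl fun b _ => ?_
  have key : ∀ r r1, g (a + q * b + (r + q * r1)) = g ((a + r) % q) * g (b + ((a + r) / q + r1)) := by
    intro r r1
    rw [hg, show a + q * b + (r + q * r1) = a + r + q * (b + r1) by ring,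
      Nat.add_mul_mod_self_left, Nat.add_mul_div_left _ _ hq]
    congr 2; ring
  rw [key, key]; ring

lemma exists_shift (q u b : ℕ) (hb : b < q) : ∃ r < q, (u + r) % q = b := by
  refine ⟨(b + (q - u % q)) % q, Nat.mod_lt _ (by omega), ?_⟩
  rw [Nat.add_mod_mod]
  have h1 := Nat.mod_add_div u q
  have h2 := Nat.mod_lt u (show 0 < q by omega)
  have : u + (b + (q - u % q)) = b + q * (u / q + 1) := by
    rw [mul_add]; omega
  rw [this, Nat.add_mul_mod_self_left, Nat.mod_eq_of_lt hb]

lemma key_bound (g : ℕ → ℤ) (q b : ℕ) (hq : 2 ≤ q) (hg : ∀ n, g n = g (n % q) * g (n / q))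
    (habs : ∀ n, |g n| = 1) (hb : b + 1 < q) (hf : g 0 * g b + g 1 * g (b + 1) = 0) (w : ℕ) :
    ∀ m u v, ∑ r ∈ Finset.range (w * q ^ m), ∑ s ∈ Finset.range (w * q ^ m),
      |FF g q m (u + r) (v + s)| ≤ (w : ℤ) ^ 2 * ((q : ℤ) ^ 3 - 2) ^ m := by
  intro m
  induction m with
  | zero => intro u v; simp [FF, abs_mul, habs, pow_two]
  | succ m ih =>
    intro u v
    set n := w * q ^ m with hn
    set B : ℤ := (w : ℤ) ^ 2 * ((q : ℤ) ^ 3 - 2) ^ m with hB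
    have hq3 : (8 : ℤ) ≤ (q : ℤ) ^ 3 := by
      have : (2 : ℤ) ≤ q := by exact_mod_cast hq
      calc (8 : ℤ) = 2 ^ 3 := by norm_num
        _ ≤ _ := by gcongr
    obtain ⟨r', hr', hr⟩ := exists_shift q u 0 (by omega)
    obtain ⟨s', hs', hs⟩ := exists_shift q v b (by omega)
    -- general
    have gen : ∀ S : Finset ℕ, ∀ r0 s0, ∑ r1 ∈ Finset.range n, ∑ s1 ∈ Finset.range n,
        |∑ a ∈ S, g ((a + (u + r0)) % q) * g ((a + (v + s0)) % q) *
          FF g q m ((a + (u + r0)) / q + r1) ((a + (v + s0)) / q + s1)| ≤ S.card * B := by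
      intro S r0 s0
      calc _ ≤ ∑ r1 ∈ Finset.range n, ∑ s1 ∈ Finset.range n, ∑ a ∈ S,
            |FF g q m ((a + (u + r0)) / q + r1) ((a + (v + s0)) / q + s1)| := by
            refine Finset.sum_le_sum fun r1 _ => Finset.sum_le_sum fun s1 _ => ?_
            refine (Finset.abs_sum_le_sum_abs _ _).trans (le_of_eq ?_)
            refine Finset.sum_congr rfl fun a _ => ?_
            rw [abs_mul, abs_mul, habs, habs, one_mul, one_mul]
        _ = ∑ a ∈ S, ∑ r1 ∈ Finset.range n, ∑ s1 ∈ Finset.range n,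
            |FF g q m ((a + (u + r0)) / q + r1) ((a + (v + s0)) / q + s1)| := by
            rw [Finset.sum_comm]
            conv_rhs => rw [Finset.sum_comm]
            rw [Finset.sum_comm]
            refine Finset.sum_congr rfl fun r1 _ => ?_
            rw [Finset.sum_comm]
        _ ≤ ∑ a ∈ S, B := Finset.sum_le_sum fun a _ => ih _ _
        _ = _ := by simp
    have loc : ∀ r0 s0, ∑ r1 ∈ Finset.range n, ∑ s1 ∈ Finset.range n,
        |FF g q (m+1) (u + r0 + q * r1) (v + s0 + q * s1)| ≤
          ((q : ℤ) - if r0 = r' then (if s0 = s' then 2 else 0) else 0) * B := by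
      intro r0 s0
      simp_rw [FF_rec g q m (by omega) hg]
      have G := gen (Finset.range q) r0 s0
      rw [Finset.card_range] at G
      split_ifs with h1 h2
      · subst h1 h2
        have G := gen (Finset.Ico 2 q) r0 s0
        rw [Nat.card_Ico, Nat.cast_sub hq] at G
        refine le_trans (le_of_eq ?_) G
        refine Finset.sum_congr rfl fun r1 _ => Finset.sum_congr rfl fun s1 _ => ?_
        congr 1
        rw [Finset.range_eq_Ico, Finset.sum_eq_sum_Ico_succ_bot (by omega),
          Finset.sum_eq_sum_Ico_succ_bot (by omega)]
        have hd : ∀ x c, x % q = c → c + 1 < q → (1 + x) % q = c + 1 ∧ (1 + x) / q = x / q := by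
          intro x c hx hc
          have := Nat.mod_add_div x q
          have e : 1 + x = (c + 1) + q * (x / q) := by omega
          rw [e, Nat.add_mul_mod_self_left, Nat.add_mul_div_left _ _ (by omega),
            Nat.div_eq_of_lt hc, Nat.mod_eq_of_lt hc]
          simp
        obtain ⟨d1, d2⟩ := hd _ _ hr (by omega)
        obtain ⟨d3, d4⟩ := hd _ _ hs hb
        simp only [zero_add] at d1 d3 ⊢
        rw [d1, d2, d3, d4, hr, hs, ← add_assoc, ← add_mul, hf]
        simp
      · simpa using G
      · simpa using G
    rw [pow_succ q m, ← mul_assoc, ← hn, sum_range_split]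
    simp_rw [sum_range_split]
    calc _ = ∑ r0 ∈ Finset.range q, ∑ s0 ∈ Finset.range q,
          ∑ r1 ∈ Finset.range n, ∑ s1 ∈ Finset.range n,
            |FF g q (m+1) (u + r0 + q * r1) (v + s0 + q * s1)| := by
          refine Finset.sum_congr rfl fun r0 _ => ?_
          rw [Finset.sum_comm]
          simp only [add_assoc]
      _ ≤ ∑ r0 ∈ Finset.range q, ∑ s0 ∈ Finset.range q,
          ((q : ℤ) - if r0 = r' then (if s0 = s' then 2 else 0) else 0) * B :=
          Finset.sum_le_sum fun r0 _ => Finset.sum_le_sum fun s0 _ => loc r0 s0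
      _ = ((q : ℤ) ^ 3 - 2) * B := by
          simp_rw [← Finset.sum_mul, Finset.sum_sub_distrib]
          congr 1
          have : ∀ x ∈ Finset.range q, (∑ s0 ∈ Finset.range q, if x = r' then (if s0 = s' then (2:ℤ) else 0) else 0)
            = if x = r' then 2 else 0 := by
            intro x _
            split_ifs <;> simp [hs']
          rw [Finset.sum_congr rfl this]
          simp [hr']; ring
      _ = _ := by rw [hB]; ring

lemma choose_a {ι : Type*} (g : ℕ → ℤ) (q m R : ℕ) (hq : 0 < q) (Y : ℤ)
    (hY : ∑ r ∈ Finset.range R, ∑ s ∈ Finset.range R, |FF g q m r s| ≤ Y)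
    (J : Finset ι) (w : ι → ℕ → ℤ) (hw : ∀ j r, |w j r| = 1) (k : ℕ)
    (hlt : 4 ^ k * (J.card * Y) < (R : ℤ) ^ 2 * q ^ m) :
    ∃ a < q ^ m, ∀ j ∈ J, 2 ^ k * |∑ r ∈ Finset.range R, w j r * g (a + r)| < (R : ℤ) := by
  have h1 : ∀ j ∈ J, ∑ a ∈ Finset.range (q ^ m), (∑ r ∈ Finset.range R, w j r * g (a + r)) ^ 2
      ≤ Y := by
    intro j _
    calc _ = ∑ r ∈ Finset.range R, ∑ s ∈ Finset.range R, w j r * w j s * FF g q m r s := by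
          simp_rw [pow_two, Finset.sum_mul_sum, FF, Finset.mul_sum]
          rw [Finset.sum_comm]
          refine Finset.sum_congr rfl fun r _ => ?_
          rw [Finset.sum_comm]
          refine Finset.sum_congr rfl fun s _ => Finset.sum_congr rfl fun a _ => ?_
          ring
      _ ≤ ∑ r ∈ Finset.range R, ∑ s ∈ Finset.range R, |FF g q m r s| := by
          refine Finset.sum_le_sum fun r _ => Finset.sum_le_sum fun s _ => ?_
          refine (le_abs_self _).trans ?_
          rw [abs_mul, abs_mul, hw, hw, one_mul, one_mul]
      _ ≤ Y := hY
  have h2 : ∑ a ∈ Finset.range (q ^ m), 4 ^ k * ∑ j ∈ J, (∑ r ∈ Finset.range R, w j r * g (a + r)) ^ 2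
      < ∑ a ∈ Finset.range (q ^ m), (R : ℤ) ^ 2 := by
    rw [← Finset.mul_sum, Finset.sum_comm]
    calc _ ≤ 4 ^ k * ∑ j ∈ J, Y := by
          gcongr with j hj; exact h1 j hj
      _ = 4 ^ k * (J.card * Y) := by simp
      _ < _ := hlt
      _ = _ := by simp [mul_comm]
  obtain ⟨a, ha, hlt'⟩ := Finset.exists_lt_of_sum_lt h2
  refine ⟨a, Finset.mem_range.1 ha, fun j hj => ?_⟩
  have h3 : (∑ r ∈ Finset.range R, w j r * g (a + r)) ^ 2 ≤ ∑ j ∈ J, (∑ r ∈ Finset.range R, w j r * g (a + r)) ^ 2 :=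
    Finset.single_le_sum (f := fun j => (∑ r ∈ Finset.range R, w j r * g (a + r)) ^ 2)
      (fun _ _ => sq_nonneg _) hj
  have h4 : (2 ^ k * |∑ r ∈ Finset.range R, w j r * g (a + r)|) ^ 2 < (R : ℤ) ^ 2 := by
    rw [mul_pow, sq_abs, ← pow_mul, mul_comm k 2, pow_mul]
    norm_num
    refine lt_of_le_of_lt ?_ hlt'
    gcongr
  exact lt_of_pow_lt_pow_left₀ 2 (by positivity) h4

lemma choose_all (P : ℕ → ℕ) (m : ℕ → ℕ) (R k : ℕ) (Y : ℕ → ℤ) (s : Finset ℕ) (hs : s.card ≤ k)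
    (g : ℕ → ℕ → ℤ) (hP : ∀ i ∈ s, 0 < P i) (habs : ∀ i n, |g i n| = 1)
    (hY : ∀ i ∈ s, ∑ r ∈ Finset.range R, ∑ t ∈ Finset.range R, |FF (g i) (P i) (m i) r t| ≤ Y i)
    (hlt : ∀ i ∈ s, 4 ^ k * (2 ^ k * Y i) < (R : ℤ) ^ 2 * P i ^ m i) :
    ∃ a : ℕ → ℕ, (∀ i ∈ s, a i < P i ^ m i) ∧ ∀ A ⊆ s, A.Nonempty →
      2 ^ k * |∑ r ∈ Finset.range R, ∏ i ∈ A, g i (a i + r)| < (R : ℤ) := by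
  induction s using Finset.induction_on with
  | empty =>
    refine ⟨0, by simp, fun A hA hne => ?_⟩
    rw [Finset.subset_empty] at hA; subst hA; simp at hne
  | insert i s hi ih =>
    rw [Finset.card_insert_of_notMem hi] at hs
    obtain ⟨a, ha, hA⟩ := ih (by omega) (fun j hj => hP j (by simp [hj]))
      (fun j hj => hY j (by simp [hj])) (fun j hj => hlt j (by simp [hj]))
    have hi0 := hY i (by simp)
    have hY0 : 0 ≤ Y i := le_trans (by positivity) hi0
    obtain ⟨x, hx, hX⟩ := choose_a (g i) (P i) (m i) R (hP i (by simp)) (Y i) hi0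
      s.powerset (fun A r => ∏ j ∈ A, g j (a j + r))
      (fun A r => by rw [Finset.abs_prod]; simp [habs]) k (by
        refine lt_of_le_of_lt ?_ (hlt i (by simp))
        rw [Finset.card_powerset]; push_cast
        gcongr
        · norm_num
        · omega)
    refine ⟨Function.update a i x, ?_, ?_⟩
    · intro j hj
      by_cases h : j = i
      · subst h; simpa using hx
      · simp [h]; exact ha j (by simpa [h] using hj)
    · intro A hAs hne
      have upd : ∀ B ⊆ s, ∀ r, ∏ j ∈ B, g j (Function.update a i x j + r) = ∏ j ∈ B, g j (a j + r) := by
        intro B hB r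
        refine Finset.prod_congr rfl fun j hj => ?_
        rw [Function.update_of_ne]
        rintro rfl; exact hi (hB hj)
      by_cases h : i ∈ A
      · have hsub : A.erase i ⊆ s := by
          intro j hj
          rw [Finset.mem_erase] at hj
          have := hAs hj.2
          simpa [hj.1] using this
        have := hX (A.erase i) (by simpa using hsub)
        convert this using 4 with r hr
        rw [← Finset.prod_erase_mul _ _ h, upd _ hsub]
        simp
      · have hsub : A ⊆ s := by
          intro j hj
          have := hAs hj
          rw [Finset.mem_insert] at this
          rcases this with rfl | h'
          · exact absurd hj h
          · exact h'
        simp_rw [upd _ hsub]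
        exact hA A hsub hne

lemma cover (R k : ℕ) (hR : 0 < R) (s : Finset ℕ) (hs : s.card ≤ k)
    (f : ℕ → ℕ → ℤ) (habs : ∀ i n, |f i n| = 1)
    (h : ∀ A ⊆ s, A.Nonempty → 2 ^ k * |∑ r ∈ Finset.range R, ∏ i ∈ A, f i r| < (R : ℤ))
    (σ : ℕ → ℤ) (hσ : ∀ i, |σ i| = 1) : ∃ r < R, ∀ i ∈ s, f i r = σ i := by
  by_contra! hcon
  have h0 : ∑ r ∈ Finset.range R, ∏ i ∈ s, (1 + σ i * f i r) = 0 := by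
    refine Finset.sum_eq_zero fun r hr => ?_
    obtain ⟨i, hi, hne⟩ := hcon r (Finset.mem_range.1 hr)
    refine Finset.prod_eq_zero hi ?_
    rcases eq_or_eq_neg_of_abs_eq (habs i r) with e | e <;>
      rcases eq_or_eq_neg_of_abs_eq (hσ i) with e' | e' <;> simp_all
  simp_rw [Finset.prod_one_add] at h0
  rw [Finset.sum_comm, ← Finset.add_sum_erase _ _ (Finset.empty_mem_powerset s)] at h0
  simp only [Finset.prod_empty, Finset.sum_const, Finset.card_range, nsmul_eq_mul, mul_one] at h0
  have h1 : (R : ℤ) ≤ ∑ A ∈ s.powerset.erase ∅, |∑ r ∈ Finset.range R, ∏ i ∈ A, f i r| := by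
    have : (R : ℤ) = - ∑ A ∈ s.powerset.erase ∅, ∑ r ∈ Finset.range R, ∏ i ∈ A, (σ i * f i r) := by
      linarith
    rw [this]
    refine (neg_le_abs _).trans ((Finset.abs_sum_le_sum_abs _ _).trans (le_of_eq ?_))
    refine Finset.sum_congr rfl fun A _ => ?_
    simp_rw [Finset.prod_mul_distrib]
    rw [← Finset.mul_sum, abs_mul, Finset.abs_prod]
    simp [hσ]
  have h2 : 2 ^ k * ∑ A ∈ s.powerset.erase ∅, |∑ r ∈ Finset.range R, ∏ i ∈ A, f i r| ≤
      ∑ A ∈ s.powerset.erase ∅, (R : ℤ) := by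
    rw [Finset.mul_sum]
    refine Finset.sum_le_sum fun A hA => ?_
    rw [Finset.mem_erase, Finset.mem_powerset] at hA
    exact (h A hA.2 (Finset.nonempty_iff_ne_empty.2 hA.1)).le
  rw [Finset.sum_const, Finset.card_erase_of_mem (Finset.empty_mem_powerset s), Finset.card_powerset,
    nsmul_eq_mul] at h2
  have h3 : ((2 ^ s.card - 1 : ℕ) : ℤ) < 2 ^ k := by
    have : 2 ^ s.card ≤ 2 ^ k := Nat.pow_le_pow_right (by norm_num) hs
    have h' : 0 < 2 ^ s.card := by positivity
    have : 2 ^ s.card - 1 < 2 ^ k := by omega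
    exact_mod_cast this
  have hR' : (0 : ℤ) < R := by exact_mod_cast hR
  nlinarith [pow_pos (show (0:ℤ) < 2 by norm_num) k]

lemma num_ineq (q Q k m : ℕ) (hk : 0 < k) (hq : 2 ≤ q) (hqQ : q ≤ Q) (hm : m = 2 * k * Q ^ 3) :
    4 * 8 ^ k * ((q : ℤ) ^ 3 - 2) ^ m < ((q : ℤ) ^ 3) ^ m := by
  have hq' : (2 : ℝ) ≤ q := by exact_mod_cast hq
  have hQ' : (q : ℝ) ≤ Q := by exact_mod_cast hqQ
  have h8 : (8 : ℝ) ≤ (q : ℝ) ^ 3 := by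
    calc (8 : ℝ) = 2 ^ 3 := by norm_num
      _ ≤ _ := by gcongr
  have h1 : (q : ℝ) ^ 3 - 2 ≤ (q : ℝ) ^ 3 * Real.exp (-(2 / (q : ℝ) ^ 3)) := by
    have := Real.add_one_le_exp (-(2 / (q : ℝ) ^ 3))
    calc (q : ℝ) ^ 3 - 2 = (q : ℝ) ^ 3 * (-(2 / (q : ℝ) ^ 3) + 1) := by field_simp; ring
      _ ≤ _ := by gcongr
  have h2 : ((q : ℝ) ^ 3 - 2) ^ m ≤ ((q : ℝ) ^ 3) ^ m * Real.exp (-(4 * k)) := by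
    calc _ ≤ ((q : ℝ) ^ 3 * Real.exp (-(2 / (q : ℝ) ^ 3))) ^ m :=
          pow_le_pow_left₀ (by linarith) h1 m
      _ = ((q : ℝ) ^ 3) ^ m * Real.exp (m * (-(2 / (q : ℝ) ^ 3))) := by
          rw [mul_pow, ← Real.exp_nat_mul]
      _ ≤ _ := by
          gcongr
          rw [hm]; push_cast
          have : (q : ℝ) ^ 3 ≤ (Q : ℝ) ^ 3 := by gcongr
          have e : 2 * (k : ℝ) * Q ^ 3 * (-(2 / (q : ℝ) ^ 3)) = -(4 * k * (Q ^ 3 / q ^ 3)) := by ring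
          rw [e]
          have : (1 : ℝ) ≤ (Q : ℝ) ^ 3 / q ^ 3 := by
            rw [le_div_iff₀ (by positivity)]; linarith
          have hk0 : (0 : ℝ) ≤ k := by positivity
          nlinarith
  have h3 : 4 * (8 : ℝ) ^ k < Real.exp (4 * k) := by
    have e1 : (32 : ℝ) < Real.exp 4 := by
      have := Real.exp_one_gt_d9
      have e : Real.exp 4 = Real.exp 1 ^ 4 := by rw [← Real.exp_nat_mul]; norm_num
      rw [e]
      calc (32 : ℝ) < 2.7 ^ 4 := by norm_num
        _ ≤ _ := by gcongr; linarith
    have e2 : Real.exp (4 * k) = Real.exp 4 ^ k := by rw [← Real.exp_nat_mul]; ring_nf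
    rw [e2]
    calc 4 * (8 : ℝ) ^ k ≤ 4 ^ k * 8 ^ k := by
          gcongr; exact le_self_pow₀ (by norm_num) (by omega)
      _ = 32 ^ k := by rw [← mul_pow]; norm_num
      _ < _ := pow_lt_pow_left₀ e1 (by norm_num) (by omega)
  have h4 : 4 * 8 ^ k * ((q : ℝ) ^ 3 - 2) ^ m < ((q : ℝ) ^ 3) ^ m := by
    calc _ ≤ 4 * 8 ^ k * (((q : ℝ) ^ 3) ^ m * Real.exp (-(4 * k))) := by gcongr
      _ < Real.exp (4 * k) * (((q : ℝ) ^ 3) ^ m * Real.exp (-(4 * k))) := by gcongr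
      _ = ((q : ℝ) ^ 3) ^ m * (Real.exp (4 * k) * Real.exp (-(4 * k))) := by ring
      _ = _ := by rw [← Real.exp_add]; simp
  exact_mod_cast h4

lemma main_nat (p : ℕ → ℕ) (k P : ℕ) (hk : 0 < k) (hp : ∀ i, (p i).Prime) (ho : ∀ i, Odd (p i))
    (hinj : Function.Injective p) (hP : ∀ i < k, p i ≤ P) (ε : ℕ → ℕ) :
    ∃ n, 0 < n ∧ n < P ^ (8 * k ^ 2 * P ^ 6) ∧ ∀ i < k, factorialExp (p i) n ≡ ε i [MOD 2] := by
  have h3 : ∀ i, 3 ≤ p i := by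
    intro i
    have h2 := (hp i).two_le
    have := ho i
    rcases Nat.lt_or_ge (p i) 3 with h | h
    · have e : p i = 2 := by omega
      rw [e] at this; exact absurd this (by decide)
    · exact h
  have hP3 : 3 ≤ P := (h3 0).trans (hP 0 hk)
  obtain ⟨m, hm⟩ : ∃ m, m = 2 * k * (P ^ 2) ^ 3 := ⟨_, rfl⟩
  obtain ⟨R, hRdef⟩ : ∃ R, R = (P ^ 2) ^ m := ⟨_, rfl⟩
  have hR : 0 < R := by rw [hRdef]; positivity
  have hqP : ∀ i < k, p i ^ 2 ≤ P ^ 2 := fun i hi => Nat.pow_le_pow_left (hP i hi) 2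
  have hqR : ∀ i < k, (p i ^ 2) ^ m ≤ R := fun i hi => by
    rw [hRdef]; exact Nat.pow_le_pow_left (hqP i hi) m
  have hq2 : ∀ i, 9 ≤ p i ^ 2 := fun i => by have := h3 i; nlinarith
  let w : ℕ → ℕ := fun i => R / (p i ^ 2) ^ m + 1
  have hw1 : ∀ i, R ≤ w i * (p i ^ 2) ^ m := by
    intro i
    have h0 : 0 < (p i ^ 2) ^ m := by have := hq2 i; positivity
    have := Nat.lt_div_mul_add (a := R) h0
    simp only [w]; rw [add_mul, one_mul]; exact this.le
  have hw2 : ∀ i < k, w i * (p i ^ 2) ^ m ≤ 2 * R := by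
    intro i hi
    have := Nat.div_mul_le_self R ((p i ^ 2) ^ m)
    have := hqR i hi
    simp only [w]; rw [add_mul, one_mul]; omega
  obtain ⟨a, ha, hA⟩ := choose_all (fun i => p i ^ 2) (fun _ => m) R k
    (fun i => (w i : ℤ) ^ 2 * (((p i ^ 2 : ℕ) : ℤ) ^ 3 - 2) ^ m) (Finset.range k) (by simp)
    (fun i => sg (p i)) (fun i _ => by have := hq2 i; positivity) (fun i n => sg_abs _ _)
    (by
      intro i hi
      obtain ⟨f1, f2⟩ := sg_flip (hp i) (h3 i)
      have := key_bound (sg (p i)) (p i ^ 2) (p i - 1) (by have := hq2 i; omega)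
        (sg_rec (hp i) (ho i)) (sg_abs _) f1 f2 (w i) m 0 0
      refine le_trans ?_ this
      simp only [zero_add]
      have hs : Finset.range R ⊆ Finset.range (w i * (p i ^ 2) ^ m) :=
        Finset.range_subset_range.2 (hw1 i)
      refine le_trans (Finset.sum_le_sum_of_subset_of_nonneg hs
        fun _ _ _ => Finset.sum_nonneg fun _ _ => abs_nonneg _) ?_
      exact Finset.sum_le_sum fun r _ => Finset.sum_le_sum_of_subset_of_nonneg hs
        fun _ _ _ => abs_nonneg _)
    (by
      intro i hi
      rw [Finset.mem_range] at hi
      have hn := num_ineq (p i ^ 2) (P ^ 2) k m hk (by have := hq2 i; omega) (hqP i hi) hm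
      have hw := hw2 i hi
      have hq := hq2 i
      generalize p i ^ 2 = q at *
      generalize w i = W at *
      have hw' : (W : ℤ) * (q : ℤ) ^ m ≤ 2 * R := by exact_mod_cast hw
      have hQ : (0 : ℤ) < (q : ℤ) ^ m := by
        have : (0 : ℤ) < q := by exact_mod_cast (show 0 < q by omega)
        positivity
      have hR' : (0 : ℤ) < R := by exact_mod_cast hR
      have hW0 : (0 : ℤ) ≤ W := by positivity
      have hD : (0 : ℤ) ≤ ((q : ℤ) ^ 3 - 2) ^ m := by
        have h9 : (9 : ℤ) ≤ q := by exact_mod_cast hq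
        have : (9 : ℤ) ^ 3 ≤ (q : ℤ) ^ 3 := by gcongr
        apply pow_nonneg; linarith
      rw [← pow_mul, mul_comm 3 m, pow_mul] at hn
      push_cast
      generalize ((q : ℤ) ^ 3 - 2) ^ m = D at *
      generalize (q : ℤ) ^ m = X at *
      have e48 : (4 : ℤ) ^ k * 2 ^ k = 8 ^ k := by rw [← mul_pow]; norm_num
      have h8 : (0 : ℤ) < 8 ^ k := by positivity
      rw [← mul_assoc, e48]
      generalize (8 : ℤ) ^ k = E at *
      have hsq : (W * X) ^ 2 ≤ (2 * (R : ℤ)) ^ 2 := by gcongr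
      have : E * ((W : ℤ) ^ 2 * D) * X ^ 2 < (R : ℤ) ^ 2 * X * X ^ 2 := by
        calc E * ((W : ℤ) ^ 2 * D) * X ^ 2 = E * D * (W * X) ^ 2 := by ring
          _ ≤ E * D * (2 * (R : ℤ)) ^ 2 := by gcongr
          _ = (R : ℤ) ^ 2 * (4 * E * D) := by ring
          _ < (R : ℤ) ^ 2 * X ^ 3 := by gcongr
          _ = _ := by ring
      exact lt_of_mul_lt_mul_right this (by positivity))
  -- CRT
  let t : ℕ → ℕ := fun i => Nat.log (p i ^ 2) (2 * R) + 1
  have ht1 : ∀ i, 2 * R < (p i ^ 2) ^ t i := fun i =>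
    Nat.lt_pow_succ_log_self (by have := hq2 i; omega) _
  have ht2 : ∀ i < k, (p i ^ 2) ^ t i ≤ P ^ (2 * m + 3) := by
    intro i hi
    have := Nat.pow_log_le_self (p i ^ 2) (show 2 * R ≠ 0 by omega)
    calc (p i ^ 2) ^ t i = (p i ^ 2) ^ Nat.log (p i ^ 2) (2 * R) * p i ^ 2 := by
          simp only [t]; rw [pow_succ]
      _ ≤ (2 * R) * P ^ 2 := Nat.mul_le_mul this (hqP i hi)
      _ ≤ (P * R) * P ^ 2 := by gcongr; omega
      _ = _ := by rw [hRdef, ← pow_mul]; ring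
  have hne : ∀ i ∈ Finset.range k, (p i ^ 2) ^ t i ≠ 0 := fun i _ => by
    have := hq2 i; positivity
  have hcop : Set.Pairwise (Finset.range k : Set ℕ)
      (Function.onFun Nat.Coprime fun i => (p i ^ 2) ^ t i) := by
    intro i _ j _ hij
    refine Nat.Coprime.pow _ _ (Nat.Coprime.pow _ _ ?_)
    exact (Nat.coprime_primes (hp i) (hp j)).2 fun h => hij (hinj h)
  obtain ⟨M, hM⟩ : ∃ M, M = ∏ i ∈ Finset.range k, (p i ^ 2) ^ t i := ⟨_, rfl⟩
  obtain ⟨n0, hn0, hlt⟩ : ∃ n0, (∀ i ∈ Finset.range k, n0 ≡ a i [MOD (p i ^ 2) ^ t i]) ∧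
      n0 < ∏ i ∈ Finset.range k, (p i ^ 2) ^ t i :=
    ⟨_, (Nat.chineseRemainderOfFinset a (fun i => (p i ^ 2) ^ t i) (Finset.range k) hne hcop).2,
      Nat.chineseRemainderOfFinset_lt_prod a (fun i => (p i ^ 2) ^ t i) hne hcop⟩
  rw [← hM] at hlt
  have hMle : M ≤ P ^ ((2 * m + 3) * k) := by
    rw [hM, pow_mul]
    calc _ ≤ ∏ i ∈ Finset.range k, P ^ (2 * m + 3) :=
          Finset.prod_le_prod' fun i hi => ht2 i (Finset.mem_range.1 hi)
      _ = _ := by simp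
  have hy : ∀ i ∈ Finset.range k, ∃ y, n0 + M = a i + (p i ^ 2) ^ t i * y := by
    intro i hi
    have h1 := hn0 i hi
    have h2 : (p i ^ 2) ^ t i ∣ M := by rw [hM]; exact Finset.dvd_prod_of_mem (fun i => (p i ^ 2) ^ t i) hi
    have h3 : n0 + M ≡ a i [MOD (p i ^ 2) ^ t i] := by
      have := h1.add ((Nat.modEq_zero_iff_dvd).2 h2)
      simpa using this
    have hle : a i ≤ n0 + M := by
      have b1 := ha i hi
      have b2 := hqR i (Finset.mem_range.1 hi)
      have b3 := ht1 i
      have b4 := Nat.le_of_dvd (by omega) h2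
      omega
    obtain ⟨y, hy⟩ := (Nat.modEq_iff_dvd' hle).1 h3.symm
    exact ⟨y, by omega⟩
  choose! y hy using hy
  obtain ⟨r, hr, hcov⟩ := cover R k hR (Finset.range k) (by simp) (fun i r => sg (p i) (a i + r))
    (fun i n => sg_abs _ _) hA (fun i => (-1) ^ ε i * sg (p i) (y i))
    (fun i => by rw [abs_mul, sg_abs, abs_pow]; simp)
  refine ⟨n0 + M + r, by omega, ?_, ?_⟩
  · have hRle : R ≤ P ^ ((2 * m + 3) * k) := by
      rw [hRdef, ← pow_mul]
      apply Nat.pow_le_pow_right (by omega)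
      nlinarith
    calc n0 + M + r < 3 * P ^ ((2 * m + 3) * k) := by omega
      _ ≤ P * P ^ ((2 * m + 3) * k) := by gcongr
      _ = P ^ ((2 * m + 3) * k + 1) := by ring
      _ ≤ _ := by
        apply Nat.pow_le_pow_right (by omega)
        rw [hm]
        have : 1 ≤ P ^ 6 := Nat.one_le_pow _ _ (by omega)
        have h6 : (P ^ 2) ^ 3 = P ^ 6 := by ring
        rw [h6]
        have hkk : k ≤ k ^ 2 := by nlinarith
        have : k ^ 2 * 1 ≤ k ^ 2 * P ^ 6 := by gcongr
        calc (2 * (2 * k * P ^ 6) + 3) * k + 1 = 4 * (k ^ 2 * P ^ 6) + 3 * k + 1 := by ring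
          _ ≤ 8 * (k ^ 2 * P ^ 6) := by omega
          _ = _ := by ring
  · intro i hi
    have hi' := Finset.mem_range.2 hi
    have h1 := hcov i hi'
    have h2 : sg (p i) (n0 + M + r) = (-1) ^ ε i := by
      rw [hy i hi', show a i + (p i ^ 2) ^ t i * y i + r = (a i + r) + (p i ^ 2) ^ t i * y i by ring,
        sg_add (hp i) (ho i), h1, mul_assoc]
      · have := sg_abs (p i) (y i)
        rw [← abs_mul_abs_self, this]; simp
      · have b1 := ha i hi'
        have b2 := hqR i hi
        have b3 := ht1 i
        omega
    unfold sg at h2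
    rw [neg_one_pow_eq_pow_mod_two, neg_one_pow_eq_pow_mod_two (ε i)] at h2
    unfold Nat.ModEq
    rcases Nat.mod_two_eq_zero_or_one (factorialExp (p i) (n0 + M + r)) with e | e <;>
      rcases Nat.mod_two_eq_zero_or_one (ε i) with e' | e' <;> rw [e, e'] at h2 ⊢ <;>
      norm_num at h2

/-- There is an absolute constant `c₃ > 0` such that for every
`k ≥ 1`, with `δ = 1/(480 k² p_k⁶)`, any positive integer `N` with
`N/2^k > c₃ k^{1/2} p_k² N^{1-δ}` admits, for every pattern `ε₁,…,ε_k ∈ {0,1}`,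
a positive integer `n < N` with `e_{pᵢ}(n) ≡ εᵢ (mod 2)` for `i = 1,…,k`. -/
theorem stmt_4 :
    ∃ c₃ : ℝ, 0 < c₃ ∧ ∀ k : ℕ, 0 < k → ∀ N : ℕ, 0 < N →
      (N : ℝ) / 2 ^ k >
        c₃ * (k : ℝ) ^ ((1 : ℝ) / 2) * (oddPrime (k - 1) : ℝ) ^ 2 *
          (N : ℝ) ^ (1 - 1 / (480 * (k : ℝ) ^ 2 * (oddPrime (k - 1) : ℝ) ^ 6)) →
      ∀ ε : ℕ → ℕ, (∀ i, ε i ≤ 1) →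
        ∃ n : ℕ, 0 < n ∧ n < N ∧
          ∀ i : ℕ, 1 ≤ i → i ≤ k → factorialExp (oddPrime (i - 1)) n ≡ ε i [MOD 2] := by
  have hinf : (Set.ofPred fun q : ℕ => q.Prime ∧ Odd q).Infinite := by
    have h := Nat.infinite_setOfPred_prime.sdiff (Set.finite_singleton 2)
    refine h.mono ?_
    rintro q ⟨hq, h2⟩
    exact ⟨hq, hq.odd_of_ne_two h2⟩
  have hmem : ∀ i, (oddPrime i).Prime ∧ Odd (oddPrime i) := fun i => Nat.nth_mem_of_infinite hinf i
  have hmono : StrictMono oddPrime := Nat.nth_strictMono hinf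
  refine ⟨1, one_pos, fun k hk N hN hlt ε _ => ?_⟩
  obtain ⟨n, hn0, hn, hpat⟩ := main_nat oddPrime k (oddPrime (k - 1)) hk (fun i => (hmem i).1)
    (fun i => (hmem i).2) hmono.injective (fun i hi => hmono.monotone (by omega)) (fun i => ε (i + 1))
  refine ⟨n, hn0, ?_, fun i h1 h2 => ?_⟩
  · refine hn.trans_le ?_
    have hP1 : 1 ≤ oddPrime (k - 1) := (hmem _).1.one_le
    generalize oddPrime (k - 1) = P at *
    have hNr : (0 : ℝ) < N := by exact_mod_cast hN
    have hPr : (1 : ℝ) ≤ P := by exact_mod_cast hP1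
    have hkr : (1 : ℝ) ≤ k := by exact_mod_cast hk
    set δ : ℝ := 1 / (480 * (k : ℝ) ^ 2 * (P : ℝ) ^ 6) with hδ
    have hNd : 0 < (N : ℝ) ^ δ := Real.rpow_pos_of_pos hNr _
    rw [Real.rpow_sub hNr, Real.rpow_one] at hlt
    have hsq : (1 : ℝ) ≤ (k : ℝ) ^ ((1 : ℝ) / 2) := Real.one_le_rpow hkr (by norm_num)
    have h2k : (1 : ℝ) ≤ 2 ^ k := one_le_pow₀ (by norm_num)
    have h1 : (P : ℝ) ^ 2 * (N / (N : ℝ) ^ δ) < N := by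
      calc (P : ℝ) ^ 2 * (N / (N : ℝ) ^ δ) ≤ 1 * (k : ℝ) ^ ((1 : ℝ) / 2) * (P : ℝ) ^ 2 * (N / (N : ℝ) ^ δ) := by
            gcongr; nlinarith [sq_nonneg (P : ℝ)]
        _ < (N : ℝ) / 2 ^ k := hlt
        _ ≤ (N : ℝ) := div_le_self hNr.le h2k
    have h2 : (P : ℝ) ^ 2 < (N : ℝ) ^ δ := by
      rw [← mul_div_assoc, div_lt_iff₀ hNd, mul_comm] at h1
      exact lt_of_mul_lt_mul_left h1 hNr.le
    have h3 : ((P : ℝ) ^ 2) ^ (480 * k ^ 2 * P ^ 6) ≤ N := by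
      calc _ ≤ ((N : ℝ) ^ δ) ^ (480 * k ^ 2 * P ^ 6) := by gcongr
        _ = N := by
          rw [← Real.rpow_natCast, ← Real.rpow_mul hNr.le, hδ]
          push_cast
          rw [one_div_mul_cancel (by positivity), Real.rpow_one]
    have h4 : (P ^ 2) ^ (480 * k ^ 2 * P ^ 6) ≤ N := by exact_mod_cast h3
    refine le_trans ?_ h4
    rw [← pow_mul]
    refine Nat.pow_le_pow_right hP1 ?_
    have : 0 ≤ k ^ 2 * P ^ 6 := Nat.zero_le _
    nlinarith
  · have := hpat (i - 1) (by omega)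
    rwa [Nat.sub_add_cancel h1] at this
end

section
/- Let p be a prime and let m ≥ 2 be an integer with p ∤ m. Write m = m′ · m″ where gcd(m′, m″) = 1, every prime factor of m′ divides p − 1, and gcd(m″, p − 1) = 1 (this decomposition exists and is unique). Then m divides (p^{μ} − 1)/(p − 1), where μ := m′ · φ(m″) and φ denotes Euler's totient function. -/
theorem aux_geom_mul (x a b : ℕ) : ∑ i ∈ Finset.range (a * b), x ^ i =
    (∑ i ∈ Finset.range a, x ^ i) * ∑ j ∈ Finset.range b, (x ^ a) ^ j := by
  induction b with
  | zero => simp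
  | succ b ih =>
    rw [Nat.mul_succ, Finset.sum_range_add, ih, Finset.sum_range_succ _ b, mul_add]
    congr 1
    rw [Finset.sum_mul]
    refine Finset.sum_congr rfl fun i _ => ?_
    rw [pow_add, pow_mul, mul_comm]

theorem aux_geom_dvd (x : ℕ) (hx : 1 ≤ x) (n : ℕ) (hn : n ≠ 0)
    (h : ∀ q : ℕ, q.Prime → q ∣ n → q ∣ x - 1) :
    n ∣ ∑ i ∈ Finset.range n, x ^ i := by
  induction n using induction_on_primes with
  | zero => exact absurd rfl hn
  | one => simp
  | prime_mul q k hq ih =>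
    have hk : k ≠ 0 := by rintro rfl; simp at hn
    have h1 := ih hk (fun r hr hd => h r hr (hd.mul_left q))
    have h2 := h q hq (dvd_mul_right q k)
    rw [mul_comm q k, aux_geom_mul]
    refine mul_dvd_mul h1 ?_
    have h3 : x ≡ 1 [MOD q] := ((Nat.modEq_iff_dvd' hx).2 h2).symm
    have h3' : (x : ZMod q) = 1 := by
      simpa using (ZMod.natCast_eq_natCast_iff x 1 q).2 h3
    rw [← ZMod.natCast_eq_zero_iff]
    simp [h3']

/-- Let `p` be prime, `m ≥ 2` with `p ∤ m`, and write `m = m' * m''`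
with `gcd(m', m'') = 1`, every prime factor of `m'` dividing `p - 1`, and
`gcd(m'', p - 1) = 1`. Then `m` divides `(p^μ - 1)/(p - 1) = 1 + p + ⋯ + p^{μ-1}`,
where `μ = m' * φ(m'')`. -/
theorem stmt_5 (p m m' m'' : ℕ) (hp : p.Prime) (hm : 2 ≤ m) (hpm : ¬ p ∣ m)
    (hmul : m = m' * m'') (hcop : Nat.Coprime m' m'')
    (hm' : ∀ q : ℕ, q.Prime → q ∣ m' → q ∣ p - 1)
    (hm'' : Nat.Coprime m'' (p - 1)) :
    m ∣ ∑ i ∈ Finset.range (m' * Nat.totient m''), p ^ i := by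
  have h0 : m' ≠ 0 := by rintro rfl; simp at hmul; omega
  subst hmul
  refine hcop.mul_dvd_of_dvd_of_dvd ?_ ?_
  · rw [aux_geom_mul]
    exact (aux_geom_dvd p hp.one_lt.le m' h0 hm').mul_right _
  · refine hm''.dvd_of_dvd_mul_right ?_
    have hc : Nat.Coprime p m'' :=
      (Nat.Prime.coprime_iff_not_dvd hp).2 fun h => hpm (h.mul_left _)
    have h1 : p ^ (m' * Nat.totient m'') ≡ 1 [MOD m''] := by
      rw [mul_comm, pow_mul]
      simpa using (Nat.ModEq.pow_totient hc).pow m'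
    have h2 := (Nat.modEq_iff_dvd' (Nat.one_le_pow _ _ hp.pos)).1 h1.symm
    have h3 := Nat.geomSum_eq hp.two_le (m' * Nat.totient m'')
    rw [h3, Nat.div_mul_cancel]
    · exact h2
    · simpa using Nat.sub_dvd_pow_sub_pow p 1 (m' * Nat.totient m'')
end

section
/- Let p be a prime, m ≥ 2 an integer with p ∤ m, and let λ be the minimal positive integer such that m divides (p^λ − 1)/(p − 1). For a non-negative integer n with base-p representation n = n_0 + n_1 p + ⋯ + n_t p^t (0 ≤ n_j ≤ p − 1), define f(n) := Σ_{j=0}^{t} n_j · (p^{j̄} − 1)/(p − 1), where j̄ is the least non-negative residue of j modulo λ. Then f(n) ≡ e_p(n) (mod m) for every non-negative integer n. -/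
/-- `kimF p l n = Σ_j n_j * (p^{j mod l} - 1)/(p - 1)`, where
`n = Σ_j n_j p^j` is the base-`p` representation of `n`
(the `j`-th base-`p` digit of `n` is `n / p^j % p`, and it vanishes for `j > n`). -/
def kimF (p l n : ℕ) : ℕ :=
  ∑ j ∈ Finset.range (n + 1), (n / p ^ j % p) * ∑ i ∈ Finset.range (j % l), p ^ i

theorem geom_mod (p m l : ℕ) (hld : m ∣ ∑ i ∈ Finset.range l, p ^ i) (r q : ℕ) :
    (∑ i ∈ Finset.range (r + l * q), p ^ i) ≡ ∑ i ∈ Finset.range r, p ^ i [MOD m] := by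
  induction q with
  | zero => simpa using Nat.ModEq.refl _
  | succ q ih =>
    have h : r + l * (q + 1) = (r + l * q) + l := by ring
    rw [h, Finset.sum_range_add]
    refine Nat.ModEq.trans ?_ ih
    have h2 : (∑ x ∈ Finset.range l, p ^ (r + l * q + x)) ≡ 0 [MOD m] := by
      simp only [pow_add _ (r + l * q), ← Finset.mul_sum]
      exact (Nat.modEq_zero_iff_dvd).2 (Dvd.dvd.mul_left hld _)
    exact Nat.ModEq.add_left _ h2

theorem digit_sum_aux (p n N : ℕ) :
    (∑ j ∈ Finset.range N, (n / p ^ j % p) * ∑ i ∈ Finset.range j, p ^ i)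
      + (n / p ^ N) * ∑ i ∈ Finset.range N, p ^ i
      = ∑ i ∈ Finset.Ico 1 (N + 1), n / p ^ i := by
  induction N with
  | zero => simp
  | succ N ih =>
    rw [Finset.sum_Ico_succ_top (by omega), ← ih, Finset.sum_range_succ]
    have h1 : ∑ i ∈ Finset.range (N + 1), p ^ i = p * (∑ i ∈ Finset.range N, p ^ i) + 1 := by
      rw [Finset.sum_range_succ', Finset.mul_sum]
      simp [pow_succ, mul_comm]
    have h2 : n / p ^ (N + 1) = n / p ^ N / p := by
      rw [pow_succ, Nat.div_div_eq_div_mul]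
    rw [h1, h2]
    have h3 := Nat.div_add_mod (n / p ^ N) p
    generalize n / p ^ N = a at *
    generalize (∑ i ∈ Finset.range N, p ^ i) = S at *
    have h4 : (p * (a / p) + a % p) * S = a * S := by rw [h3]
    linarith

/-- Let `p` be prime, `m ≥ 2` with `p ∤ m`, and let `λ` be the
minimal positive integer with `m ∣ (p^λ - 1)/(p - 1)`. Then the function
`f(n) = Σ_j n_j (p^{j̄} - 1)/(p - 1)` (sum over the base-`p` digits `n_j` of `n`,
with `j̄ = j mod λ`) satisfies `f(n) ≡ e_p(n) (mod m)` for all `n ≥ 0`. -/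
theorem stmt_8 (p m l : ℕ) (hp : p.Prime) (hm : 2 ≤ m) (hpm : ¬ p ∣ m)
    (hl : 0 < l) (hld : m ∣ ∑ i ∈ Finset.range l, p ^ i)
    (hlmin : ∀ l' : ℕ, 0 < l' → m ∣ ∑ i ∈ Finset.range l', p ^ i → l ≤ l') :
    ∀ n : ℕ, kimF p l n ≡ factorialExp p n [MOD m] := by
  intro n
  have hp2 := hp.two_le
  have hn : n < p ^ (n + 1) :=
    lt_trans (Nat.lt_succ_self n) (Nat.lt_pow_self hp.one_lt)
  have hlog : Nat.log p n < n + 2 := by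
    have := Nat.log_le_self p n
    omega
  have key := digit_sum_aux p n (n + 1)
  rw [Nat.div_eq_of_lt hn, zero_mul, add_zero] at key
  have hfe : factorialExp p n = ∑ i ∈ Finset.Ico 1 (n + 2), n / p ^ i :=
    Nat.factorization_factorial hp hlog
  rw [hfe, ← key, kimF]
  have hj : ∀ j, (∑ i ∈ Finset.range (j % l), p ^ i) ≡ ∑ i ∈ Finset.range j, p ^ i [MOD m] := by
    intro j
    have := geom_mod p m l hld (j % l) (j / l)
    rw [Nat.mod_add_div] at this
    exact this.symm
  generalize n + 1 = N
  induction N with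
  | zero => exact Nat.ModEq.refl _
  | succ N ih =>
    rw [Finset.sum_range_succ, Finset.sum_range_succ]
    exact ih.add ((hj N).mul_left _)
end

section
/- Let p be a prime and λ a positive integer, and set q := p^λ. For a non-negative integer n with base-p representation n = n_0 + n_1 p + ⋯ + n_t p^t (0 ≤ n_j ≤ p − 1), define f(n) := Σ_{j=0}^{t} n_j · (p^{j̄} − 1)/(p − 1), where j̄ is the least non-negative residue of j modulo λ. Then f is completely q-additive: f(0) = 0 and f(a·q^s + b) = f(a) + f(b) for all integers a ≥ 1, s ≥ 1, and 0 ≤ b < q^s. -/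
theorem kimF_eq (p l n N : ℕ) (hp : 1 < p) (h : n < p ^ N) :
    kimF p l n = ∑ j ∈ Finset.range N, (n / p ^ j % p) * ∑ i ∈ Finset.range (j % l), p ^ i := by
  have key : ∀ A B : ℕ, A ≤ B → n < p ^ A →
      ∑ j ∈ Finset.range A, (n / p ^ j % p) * ∑ i ∈ Finset.range (j % l), p ^ i =
      ∑ j ∈ Finset.range B, (n / p ^ j % p) * ∑ i ∈ Finset.range (j % l), p ^ i := by
    intro A B hAB hA
    apply Finset.sum_subset
    · intro x hx
      simp only [Finset.mem_range] at *
      omega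
    · intro x _ hx
      have hx' : A ≤ x := by simpa using hx
      have : n < p ^ x := lt_of_lt_of_le hA (Nat.pow_le_pow_right (by omega) hx')
      rw [Nat.div_eq_of_lt this]
      simp
  have h1 : n < p ^ (n + 1) := lt_trans (Nat.lt_succ_self n) (Nat.lt_pow_self hp)
  unfold kimF
  rcases le_total N (n + 1) with hN | hN
  · exact (key _ _ hN h).symm
  · exact key _ _ hN h1

/-- Let `p` be prime, `λ ≥ 1`, and `q = p^λ`. The function
`f(n) = Σ_j n_j (p^{j mod λ} - 1)/(p - 1)` (sum over the base-`p` digits `n_j`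
of `n`) is completely `q`-additive: `f(0) = 0` and
`f(a q^s + b) = f(a) + f(b)` for all `a ≥ 1`, `s ≥ 1`, `0 ≤ b < q^s`. -/
theorem stmt_9 (p l : ℕ) (hp : p.Prime) (hl : 0 < l) :
    kimF p l 0 = 0 ∧
      ∀ a s b : ℕ, 1 ≤ a → 1 ≤ s → b < (p ^ l) ^ s →
        kimF p l (a * (p ^ l) ^ s + b) = kimF p l a + kimF p l b := by
  refine ⟨by simp [kimF], ?_⟩
  intro a s b _ _ hb
  have hp1 := hp.one_lt
  rw [← pow_mul] at hb ⊢
  set m := l * s with hm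
  have ha : a < p ^ a := Nat.lt_pow_self hp1
  have hn : a * p ^ m + b < p ^ (m + a) := by
    rw [pow_add]
    nlinarith
  rw [kimF_eq p l _ _ hp1 hn, kimF_eq p l a a hp1 ha, kimF_eq p l b m hp1 hb,
    Finset.sum_range_add, add_comm]
  congr 1
  · apply Finset.sum_congr rfl
    intro j _
    rw [pow_add, ← Nat.div_div_eq_div_mul, mul_comm a, Nat.mul_add_div (by positivity),
      Nat.div_eq_of_lt hb, hm, Nat.mul_add_mod, add_zero]
  · apply Finset.sum_congr rfl
    intro j hj
    obtain ⟨k, hk⟩ := Nat.exists_eq_add_of_lt (Finset.mem_range.mp hj)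
    have e : a * p ^ m + b = p ^ j * (p * (p ^ k * a)) + b := by
      rw [hk]; ring
    rw [e, Nat.mul_add_div (by have := hp.pos; positivity), Nat.mul_add_mod]
end

section
/- Let q_1, …, q_k be pairwise coprime integers with q_i ≥ 2, let m_1, …, m_k be integers with m_i ≥ 2, and for each i let f_i be an integer-valued completely q_i-additive function. Set F_i := f_i(1) and d_i := gcd(m_i, (q_i − 1)F_i, and f_i(r) − r·F_i for all 2 ≤ r ≤ q_i − 1). Assume gcd(F_i, d_i) = 1 for all i and gcd(d_i, d_j) = 1 for all i ≠ j. Set q := max{q_i : 1 ≤ i ≤ k}, m := max{m_i : 1 ≤ i ≤ k}, and δ_1 := 1/(120 k² q³ m²). Then there exists a constant C > 0 such that for all integers a_1, …, a_k and every positive integer N, | #{0 ≤ n < N : f_i(n) ≡ a_i (mod m_i) for all 1 ≤ i ≤ k} − N/(m_1 ⋯ m_k) | ≤ C · N^{1−δ_1}. -/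
section KimAux
open Finset ComplexConjugate

lemma kim_root_gap (ω : ℂ) (m : ℕ) (hm : 2 ≤ m) (h : ω ^ m = 1) (h1 : ω ≠ 1) (hn : ‖ω‖ = 1) :
    ‖1 + ω‖ ≤ 2 - 1 / (m : ℝ) ^ 2 := by
  have hm' : (2 : ℝ) ≤ m := by exact_mod_cast hm
  have hgeom : ∑ l ∈ range m, ω ^ l = 0 := by
    rw [geom_sum_eq h1, h]; simp
  have hpow : ∀ l : ℕ, ‖1 - ω ^ l‖ ≤ l * ‖1 - ω‖ := by
    intro l
    induction l with
    | zero => simp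
    | succ l ih =>
      have : 1 - ω ^ (l + 1) = (1 - ω ^ l) + ω ^ l * (1 - ω) := by ring
      rw [this]
      refine (norm_add_le _ _).trans ?_
      rw [norm_mul, norm_pow, hn, one_pow]
      push_cast
      linarith
  have hsum : (m : ℝ) ≤ ((m : ℝ) * m / 2) * ‖1 - ω‖ := by
    have e1 : (m : ℂ) = ∑ l ∈ range m, (1 - ω ^ l) := by
      rw [sum_sub_distrib, hgeom]; simp
    have e2 : (m : ℝ) = ‖(m : ℂ)‖ := by simp
    have e3 : ∑ l ∈ range m, (l : ℝ) ≤ (m : ℝ) * m / 2 := by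
      clear * -
      induction m with
      | zero => simp
      | succ m ih => rw [sum_range_succ]; push_cast; nlinarith
    calc (m : ℝ) = ‖∑ l ∈ range m, (1 - ω ^ l)‖ := by rw [← e1]; exact e2
      _ ≤ ∑ l ∈ range m, ‖1 - ω ^ l‖ := norm_sum_le _ _
      _ ≤ ∑ l ∈ range m, l * ‖1 - ω‖ := sum_le_sum fun l _ => hpow l
      _ = (∑ l ∈ range m, (l : ℝ)) * ‖1 - ω‖ := by rw [sum_mul]
      _ ≤ _ := by gcongr
  have hpar : ‖1 + ω‖ ^ 2 + ‖1 - ω‖ ^ 2 = 4 := by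
    have := parallelogram_law_with_norm ℝ (1 : ℂ) ω
    simp only [hn, norm_one] at this
    nlinarith
  have hlow : 2 / (m : ℝ) ≤ ‖1 - ω‖ := by
    rw [div_le_iff₀ (by linarith)]
    have : (m : ℝ) * 1 ≤ m * (m / 2 * ‖1 - ω‖) := by linarith
    have := le_of_mul_le_mul_left this (by linarith)
    linarith
  have hsq : 4 * (1 / (m : ℝ) ^ 2) ≤ ‖1 - ω‖ ^ 2 := by
    have : (2 / (m : ℝ)) ^ 2 ≤ ‖1 - ω‖ ^ 2 := by gcongr
    calc _ = (2 / (m : ℝ)) ^ 2 := by ring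
      _ ≤ _ := this
  have hle : 1 / (m : ℝ) ^ 2 ≤ 1 := by
    rw [div_le_one (by positivity)]; nlinarith
  refine abs_le_of_sq_le_sq' ?_ (by linarith) |>.2
  nlinarith [sq_nonneg (1 / (m : ℝ) ^ 2)]

lemma kim_pair {T : Type*} (S : Finset ℕ) (u : ℕ → ℂ) (hu : ∀ b, ‖u b‖ ≤ 1) (P : Finset T)
    (φ ψ : T → ℕ) (hφ : ∀ x ∈ P, φ x ∈ S) (hψ : ∀ x ∈ P, ψ x ∈ S)
    (iφ : Set.InjOn φ P) (iψ : Set.InjOn ψ P) (hd : ∀ x ∈ P, ∀ y ∈ P, φ x ≠ ψ y)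
    (ε : ℝ) (hε : ∀ x ∈ P, ‖u (φ x) + u (ψ x)‖ ≤ 2 - ε) :
    ‖∑ b ∈ S, u b‖ ≤ (S.card : ℝ) - P.card * ε := by
  classical
  have hdis : Disjoint (P.image φ) (P.image ψ) := by
    rw [Finset.disjoint_left]
    intro a ha hb
    obtain ⟨x, hx, rfl⟩ := mem_image.1 ha
    obtain ⟨y, hy, h⟩ := mem_image.1 hb
    exact hd x hx y hy h.symm
  set V := P.image φ ∪ P.image ψ with hV
  have hVS : V ⊆ S := by
    intro a ha
    rcases mem_union.1 ha with h | h
    · obtain ⟨x, hx, rfl⟩ := mem_image.1 h; exact hφ x hx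
    · obtain ⟨x, hx, rfl⟩ := mem_image.1 h; exact hψ x hx
  have hVc : V.card = 2 * P.card := by
    rw [hV, card_union_of_disjoint hdis, card_image_of_injOn iφ, card_image_of_injOn iψ]; ring
  have hsV : ∑ b ∈ V, u b = ∑ x ∈ P, (u (φ x) + u (ψ x)) := by
    rw [hV, sum_union hdis, sum_image iφ, sum_image iψ, sum_add_distrib]
  have h1 : ‖∑ b ∈ V, u b‖ ≤ P.card * (2 - ε) := by
    rw [hsV]
    refine (norm_sum_le _ _).trans ((sum_le_sum hε).trans ?_)
    rw [sum_const, nsmul_eq_mul]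
  have h2 : ‖∑ b ∈ S \ V, u b‖ ≤ ((S \ V).card : ℝ) := by
    refine (norm_sum_le _ _).trans ((sum_le_sum fun b _ => hu b).trans ?_)
    simp
  have h3 : ((S \ V).card : ℝ) + 2 * P.card = S.card := by
    have := card_sdiff_add_card_eq_card hVS
    rw [hVc] at this
    exact_mod_cast this
  rw [← sum_sdiff hVS]
  refine (norm_add_le _ _).trans ?_
  nlinarith

noncomputable def kimCorr (g : ℕ → ℂ) (L r : ℕ) : ℂ := ∑ n ∈ range L, g (n + r) * conj (g n)

lemma kim_sum_mul {M : Type*} [AddCommMonoid M] (F : ℕ → M) (Q L : ℕ) :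
    ∑ n ∈ range (Q * L), F n = ∑ n ∈ range L, ∑ b ∈ range Q, F (Q * n + b) := by
  induction L with
  | zero => simp
  | succ L ih => rw [Nat.mul_succ, sum_range_add, ih, sum_range_succ]

lemma kim_corr_norm (g : ℕ → ℂ) (hg : ∀ n, ‖g n‖ = 1) (L r : ℕ) : ‖kimCorr g L r‖ ≤ L := by
  refine (norm_sum_le _ _).trans ?_
  simp [hg]

lemma kim_corr_rec (g : ℕ → ℂ) (Q : ℕ) (hmul : ∀ n b, b < Q → g (Q * n + b) = g n * g b)
    (L r s : ℕ) (hs : s < Q) :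
    kimCorr g (Q * L) (Q * r + s) = kimCorr g (Q - s) s * kimCorr g L r +
      (∑ b ∈ range s, g b * conj (g (Q - s + b))) * kimCorr g L (r + 1) := by
  unfold kimCorr
  rw [kim_sum_mul, mul_sum, mul_sum, ← sum_add_distrib]
  refine sum_congr rfl fun n _ => ?_
  have : range Q = range ((Q - s) + s) := by congr 1; omega
  rw [this, sum_range_add, sum_mul, sum_mul]
  congr 1
  · refine sum_congr rfl fun b hb => ?_
    rw [mem_range] at hb
    have e : Q * n + b + (Q * r + s) = Q * (n + r) + (b + s) := by ring
    rw [e, hmul _ _ (by omega), hmul _ _ (by omega), map_mul]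
    ring
  · refine sum_congr rfl fun b hb => ?_
    rw [mem_range] at hb
    have e : Q * n + (Q - s + b) + (Q * r + s) = Q * (n + (r + 1)) + b := by
      have : Q - s + s = Q := by omega
      calc _ = Q * n + Q * r + (Q - s + s) + b := by ring
        _ = _ := by rw [this]; ring
    rw [e, hmul _ _ (by omega), hmul _ _ (by omega), map_mul]
    ring

lemma kim_step (g : ℕ → ℂ) (hg : ∀ n, ‖g n‖ = 1) (Q : ℕ)
    (hmul : ∀ n b, b < Q → g (Q * n + b) = g n * g b) (τ : ℝ) (s₀ : ℕ) (hs₀ : s₀ < Q)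
    (hsav : ‖kimCorr g (Q - s₀) s₀‖ ≤ (Q : ℝ) - s₀ - τ) (L R : ℕ) :
    ∑ r ∈ range (Q * R), ‖kimCorr g (Q * L) r‖ ≤
      ((Q : ℝ) ^ 2 - τ) * ∑ r ∈ range R, ‖kimCorr g L r‖ + (Q : ℝ) ^ 2 * L := by
  set a : ℕ → ℝ := fun s => ‖kimCorr g (Q - s) s‖ with ha
  set b : ℕ → ℝ := fun s => ‖∑ b ∈ range s, g b * conj (g (Q - s + b))‖ with hb
  set x : ℕ → ℝ := fun r => ‖kimCorr g L r‖ with hx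
  have hbs : ∀ s, b s ≤ s := by
    intro s
    refine (norm_sum_le _ _).trans ?_
    simp [hg]
  have hb0 : ∀ s, 0 ≤ b s := fun s => norm_nonneg _
  have hx0 : ∀ s, 0 ≤ x s := fun s => norm_nonneg _
  have hAB : ∑ s ∈ range Q, a s + ∑ s ∈ range Q, b s ≤ (Q : ℝ) ^ 2 - τ := by
    rw [← sum_add_distrib]
    have : ∀ s ∈ range Q, a s + b s ≤ (Q : ℝ) - (if s = s₀ then τ else 0) := by
      intro s hs
      rw [mem_range] at hs
      split_ifs with h
      · subst h
        have := hbs s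
        simp only [ha]; linarith
      · have h1 := hbs s
        have h2 := kim_corr_norm g hg (Q - s) s
        rw [Nat.cast_sub hs.le] at h2
        simp only [ha]; linarith
    refine (sum_le_sum this).trans ?_
    rw [sum_sub_distrib, sum_ite_eq' , if_pos (mem_range.2 hs₀)]
    simp [sq]
  have hB : ∑ s ∈ range Q, b s ≤ (Q : ℝ) ^ 2 := by
    have : ∀ s ∈ range Q, b s ≤ (Q : ℝ) := fun s hs =>
      (hbs s).trans (by exact_mod_cast (mem_range.1 hs).le)
    refine (sum_le_sum this).trans ?_
    simp [sq]
  have hB0 : 0 ≤ ∑ s ∈ range Q, b s := sum_nonneg fun s _ => hb0 s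
  have hshift : ∑ r ∈ range R, x (r + 1) ≤ ∑ r ∈ range R, x r + L := by
    have h1 := sum_range_succ x R
    have h2 := sum_range_succ' x R
    have h3 : x R ≤ L := kim_corr_norm g hg L R
    have := hx0 0
    linarith
  have hX0 : 0 ≤ ∑ r ∈ range R, x r := sum_nonneg fun s _ => hx0 s
  rw [kim_sum_mul]
  calc ∑ r ∈ range R, ∑ s ∈ range Q, ‖kimCorr g (Q * L) (Q * r + s)‖
      ≤ ∑ r ∈ range R, ∑ s ∈ range Q, (a s * x r + b s * x (r + 1)) := by
        refine sum_le_sum fun r _ => sum_le_sum fun s hs => ?_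
        rw [kim_corr_rec g Q hmul L r s (mem_range.1 hs)]
        refine (norm_add_le _ _).trans ?_
        rw [norm_mul, norm_mul]
    _ = (∑ s ∈ range Q, a s) * ∑ r ∈ range R, x r +
        (∑ s ∈ range Q, b s) * ∑ r ∈ range R, x (r + 1) := by
        simp only [sum_add_distrib, ← sum_mul, ← mul_sum]
    _ ≤ _ := by
        have hL : (0 : ℝ) ≤ L := Nat.cast_nonneg _
        have e1 := mul_le_mul_of_nonneg_left hshift hB0
        have e2 := mul_le_mul_of_nonneg_right hAB hX0
        have e3 := mul_le_mul_of_nonneg_right hB hL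
        nlinarith

lemma kim_avg (g : ℕ → ℂ) (hg : ∀ n, ‖g n‖ = 1) (Q : ℕ) (hQ : 2 ≤ Q)
    (hmul : ∀ n b, b < Q → g (Q * n + b) = g n * g b) (y : ℝ) (s₀ : ℕ) (hs₀ : s₀ < Q)
    (hsav : ‖kimCorr g (Q - s₀) s₀‖ ≤ (Q : ℝ) - s₀ - ((Q : ℝ) ^ 2 - y))
    (hy : 3 / 4 * (Q : ℝ) ^ 2 ≤ y) (L j : ℕ) :
    ∑ r ∈ range (Q ^ j), ‖kimCorr g (Q ^ j * L) r‖ ≤ L * (5 * y ^ j - 4 * (Q : ℝ) ^ j) := by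
  induction j with
  | zero =>
    simp only [pow_zero, one_mul, sum_range_one]
    have := kim_corr_norm g hg L 0
    linarith
  | succ j ih =>
    have hs := kim_step g hg Q hmul ((Q : ℝ) ^ 2 - y) s₀ hs₀ hsav (Q ^ j * L) (Q ^ j)
    have e1 : Q ^ (j + 1) = Q * Q ^ j := by ring
    rw [e1, mul_assoc]
    refine hs.trans ?_
    have hQ' : (2 : ℝ) ≤ Q := by exact_mod_cast hQ
    have hy0 : 0 ≤ y := le_trans (by positivity) hy
    have := mul_le_mul_of_nonneg_left ih hy0
    have h3 : (0 : ℝ) ≤ L * (Q : ℝ) ^ j := by positivity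
    have h4 : (0 : ℝ) ≤ 4 * y - (Q : ℝ) ^ 2 - 4 * Q := by nlinarith
    have h5 := mul_nonneg h3 h4
    push_cast
    rw [sub_sub_cancel, pow_succ y j, pow_succ (Q : ℝ) j]
    linarith

lemma kim_shift (H : ℕ → ℂ) (hH : ∀ n, ‖H n‖ ≤ 1) (N r : ℕ) :
    ‖∑ n ∈ range N, H (n + r) - ∑ n ∈ range N, H n‖ ≤ 2 * r := by
  have h1 : ∑ n ∈ range r, H n + ∑ n ∈ range N, H (n + r) =
      ∑ n ∈ range N, H n + ∑ n ∈ range r, H (N + n) := by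
    rw [← sum_range_add, add_comm N r, sum_range_add]
    simp only [add_comm]
  have h2 : ∑ n ∈ range N, H (n + r) - ∑ n ∈ range N, H n =
      ∑ n ∈ range r, H (N + n) - ∑ n ∈ range r, H n := by
    linear_combination h1
  have b : ∀ K : ℕ → ℂ, (∀ n, ‖K n‖ ≤ 1) → ‖∑ n ∈ range r, K n‖ ≤ r := by
    intro K hK
    refine (norm_sum_le _ _).trans ((sum_le_sum fun n _ => hK n).trans ?_)
    simp
  rw [h2]
  refine (norm_sub_le _ _).trans ?_
  have := b _ hH
  have := b (fun n => H (N + n)) (fun n => hH _)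
  linarith

lemma kim_dist (c : ℕ → ℝ) (hc : ∀ n, 0 ≤ c n) (R r : ℕ) (hr : r < R) :
    ∑ x ∈ range R, c ((r - x) + (x - r)) ≤ 2 * ∑ s ∈ range R, c s := by
  have e : range R = range ((r + 1) + (R - r - 1)) := by congr 1; omega
  have h1 : ∑ x ∈ range (r + 1), c ((r - x) + (x - r)) ≤ ∑ s ∈ range R, c s := by
    have : ∑ x ∈ range (r + 1), c ((r - x) + (x - r)) = ∑ x ∈ range (r + 1), c x := by
      rw [← sum_range_reflect]
      refine sum_congr rfl fun x hx => ?_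
      rw [mem_range] at hx
      congr 1
      omega
    rw [this]
    exact sum_le_sum_of_subset_of_nonneg (range_mono (by omega)) fun _ _ _ => hc _
  have h2 : ∑ x ∈ range (R - r - 1), c ((r - (r + 1 + x)) + ((r + 1 + x) - r)) ≤
      ∑ s ∈ range R, c s := by
    have : ∑ x ∈ range (R - r - 1), c ((r - (r + 1 + x)) + ((r + 1 + x) - r)) =
        ∑ x ∈ range (R - r - 1), c (x + 1) := by
      refine sum_congr rfl fun x hx => ?_
      congr 1
      omega
    rw [this]
    have h3 := sum_range_succ' c (R - r - 1)
    have h4 : ∑ s ∈ range (R - r - 1 + 1), c s ≤ ∑ s ∈ range R, c s :=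
      sum_le_sum_of_subset_of_nonneg (range_mono (by omega)) fun _ _ _ => hc _
    have := hc 0
    linarith
  calc _ = ∑ x ∈ range ((r + 1) + (R - r - 1)), c ((r - x) + (x - r)) := by rw [← e]
    _ ≤ _ := by rw [sum_range_add]; linarith

lemma kim_vdc (G : ℕ → ℂ) (hG : ∀ n, ‖G n‖ = 1) (N R : ℕ) :
    (R : ℝ) ^ 2 * ‖∑ n ∈ range N, G n‖ ^ 2 ≤
      4 * N * R * ∑ s ∈ range R, ‖kimCorr G N s‖ + 4 * N * R ^ 3 + 8 * R ^ 4 := by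
  set S := ∑ n ∈ range N, G n with hS
  set c : ℕ → ℝ := fun s => ‖kimCorr G N s‖ with hc
  have hc0 : ∀ n, 0 ≤ c n := fun n => norm_nonneg _
  set T := ∑ n ∈ range N, ‖∑ r ∈ range R, G (n + r)‖ with hT
  have hT0 : 0 ≤ T := sum_nonneg fun _ _ => norm_nonneg _
  have h1 : R * ‖S‖ ≤ T + 2 * R ^ 2 := by
    have e : (R : ℂ) * S = ∑ n ∈ range N, ∑ r ∈ range R, G (n + r) -
        ∑ r ∈ range R, (∑ n ∈ range N, G (n + r) - ∑ n ∈ range N, G n) := by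
      rw [sum_comm, sum_sub_distrib]; simp [hS]
    have e2 : (R : ℝ) * ‖S‖ = ‖(R : ℂ) * S‖ := by simp
    rw [e2, e]
    refine (norm_sub_le _ _).trans (add_le_add (norm_sum_le _ _) ?_)
    refine (norm_sum_le _ _).trans ?_
    calc _ ≤ ∑ r ∈ range R, 2 * (R : ℝ) := by
          refine sum_le_sum fun r hr => (kim_shift G (fun n => (hG n).le) N r).trans ?_
          have : (r : ℝ) ≤ R := by exact_mod_cast (mem_range.1 hr).le
          linarith
      _ = _ := by simp; ring
  have hpair : ∀ r ∈ range R, ∀ x ∈ range R,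
      ‖∑ n ∈ range N, G (n + r) * conj (G (n + x))‖ ≤ c ((r - x) + (x - r)) + 2 * R := by
    have key : ∀ r x : ℕ, x ≤ r → x < R →
      ‖∑ n ∈ range N, G (n + r) * conj (G (n + x))‖ ≤ c (r - x) + 2 * R := by
      intro r x hx hxR
      have := kim_shift (fun n => G (n + (r - x)) * conj (G n)) (by intro n; simp [hG]) N x
      have e : ∀ n, n + x + (r - x) = n + r := by intro n; omega
      simp only [e] at this
      have h2 : (x : ℝ) ≤ R := by exact_mod_cast hxR.le
      have h3 := norm_le_norm_add_norm_sub' (∑ n ∈ range N, G (n + r) * conj (G (n + x)))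
        (∑ n ∈ range N, G (n + (r - x)) * conj (G n))
      simp only [hc, kimCorr]
      linarith
    intro r hr x hx
    rw [mem_range] at hr hx
    rcases le_total x r with h | h
    · have := key r x h hx
      rwa [Nat.sub_eq_zero_of_le h, add_zero]
    · have := key x r h hr
      rw [Nat.sub_eq_zero_of_le h, zero_add]
      rw [← Complex.norm_conj, map_sum]
      simpa only [map_mul, Complex.conj_conj, mul_comm] using this
  have hsq : ∑ n ∈ range N, ‖∑ r ∈ range R, G (n + r)‖ ^ 2 ≤
      2 * R * ∑ s ∈ range R, c s + 2 * R ^ 3 := by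
    have e : ((∑ n ∈ range N, ‖∑ r ∈ range R, G (n + r)‖ ^ 2 : ℝ) : ℂ) =
        ∑ r ∈ range R, ∑ x ∈ range R, ∑ n ∈ range N, G (n + r) * conj (G (n + x)) := by
      push_cast
      rw [sum_congr rfl (fun r _ => sum_comm), sum_comm]
      refine sum_congr rfl fun n _ => ?_
      rw [← Complex.mul_conj', map_sum, sum_mul_sum]
    have e2 : ∑ n ∈ range N, ‖∑ r ∈ range R, G (n + r)‖ ^ 2 =
        ‖((∑ n ∈ range N, ‖∑ r ∈ range R, G (n + r)‖ ^ 2 : ℝ) : ℂ)‖ := by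
      rw [Complex.norm_real, Real.norm_of_nonneg]
      positivity
    rw [e2, e]
    calc _ ≤ ∑ r ∈ range R, ∑ x ∈ range R, (c ((r - x) + (x - r)) + 2 * R) := by
          refine (norm_sum_le _ _).trans (sum_le_sum fun r hr => ?_)
          exact (norm_sum_le _ _).trans (sum_le_sum fun x hx => hpair r hr x hx)
      _ ≤ ∑ r ∈ range R, (2 * ∑ s ∈ range R, c s + 2 * R ^ 2) := by
          refine sum_le_sum fun r hr => ?_
          rw [sum_add_distrib]
          refine add_le_add (kim_dist c hc0 R r (mem_range.1 hr)) ?_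
          simp; apply le_of_eq; ring
      _ = _ := by simp; ring
  have hcs : T ^ 2 ≤ N * ∑ n ∈ range N, ‖∑ r ∈ range R, G (n + r)‖ ^ 2 := by
    have := sq_sum_le_card_mul_sum_sq (s := range N) (f := fun n => ‖∑ r ∈ range R, G (n + r)‖)
    simpa using this
  have hN : (0 : ℝ) ≤ N := Nat.cast_nonneg _
  have h4 := mul_le_mul_of_nonneg_left hsq hN
  have h5 : (R * ‖S‖) ^ 2 ≤ (T + 2 * R ^ 2) ^ 2 := by gcongr
  have h6 : (T + 2 * (R : ℝ) ^ 2) ^ 2 ≤ 2 * T ^ 2 + 8 * R ^ 4 := by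
    nlinarith [sq_nonneg (T - 2 * (R : ℝ) ^ 2)]
  have h7 : (R * ‖S‖) ^ 2 = (R : ℝ) ^ 2 * ‖S‖ ^ 2 := by ring
  rw [← h7]
  linarith

lemma kim_count (N Q s : ℕ) (hQ : 0 < Q) :
    ((((range N).filter (fun n => Q ≤ n % Q + s)).card : ℕ) : ℝ) ≤ ((N : ℝ) / Q + 1) * s := by
  have h1 : ((range N).filter (fun n => Q ≤ n % Q + s)).card ≤ (N / Q + 1) * s := by
    calc _ ≤ ((range (Q * (N / Q + 1))).filter (fun n => Q ≤ n % Q + s)).card := by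
          apply card_le_card
          apply filter_subset_filter
          apply range_mono
          have := Nat.lt_mul_div_succ N hQ
          simpa using this.le
      _ = ∑ n ∈ range (Q * (N / Q + 1)), if Q ≤ n % Q + s then 1 else 0 := by
          rw [card_filter]
      _ = ∑ n ∈ range (N / Q + 1), ∑ b ∈ range Q, if Q ≤ b + s then 1 else 0 := by
          rw [kim_sum_mul]
          refine sum_congr rfl fun n _ => sum_congr rfl fun b hb => ?_
          rw [Nat.mul_add_mod, Nat.mod_eq_of_lt (mem_range.1 hb)]
      _ ≤ ∑ n ∈ range (N / Q + 1), s := by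
          refine sum_le_sum fun n _ => ?_
          rw [← card_filter]
          calc _ ≤ (Ico (Q - s) Q).card := by
                apply card_le_card
                intro b hb
                simp only [mem_filter, mem_range, mem_Ico] at hb ⊢
                omega
            _ ≤ s := by simp; omega
      _ = _ := by simp
  calc _ ≤ (((N / Q + 1) * s : ℕ) : ℝ) := by exact_mod_cast h1
    _ ≤ _ := by
      push_cast
      gcongr
      exact Nat.cast_div_le

lemma kim_crt (c H : ℕ → ℂ) (A B : ℕ) (hA : 0 < A) (hB : 0 < B) (hAB : Nat.Coprime A B)
    (hc : ∀ n, c (n % A) = c n) (hH : ∀ n, H (n % B) = H n) (hc1 : ∀ n, ‖c n‖ ≤ 1)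
    (hH1 : ∀ n, ‖H n‖ ≤ 1) (N : ℕ) :
    ‖∑ n ∈ range N, c n * H n‖ ≤ (N : ℝ) / A * ‖∑ x ∈ range A, c x‖ + A * B := by
  have full : ∀ l, ‖∑ b ∈ range (B * A), c (B * A * l + b) * H (B * A * l + b)‖ ≤
      B * ‖∑ x ∈ range A, c x‖ := by
    intro l
    have e0 : ∀ b, c (B * A * l + b) * H (B * A * l + b) = c b * H b := by
      intro b
      have h1 : (B * A * l + b) % A = b % A := by
        rw [mul_comm B A, mul_assoc, Nat.mul_add_mod]
      have h2 : (B * A * l + b) % B = b % B := by rw [mul_assoc, Nat.mul_add_mod]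
      rw [← hc, h1, ← hH (B * A * l + b), h2, hc, hH]
    simp only [e0]
    rw [kim_sum_mul, sum_comm]
    have e1 : ∀ u ∈ range B, ∑ n ∈ range A, c (B * n + u) * H (B * n + u) =
        H u * ∑ x ∈ range A, c x := by
      intro u _
      have : ∀ n, H (B * n + u) = H u := by
        intro n
        rw [← hH, Nat.mul_add_mod, hH]
      simp only [this]
      rw [← sum_mul, mul_comm]
      congr 1
      have inj : Set.InjOn (fun n => (B * n + u) % A) (range A) := by
        intro x hx y hy hxy
        simp only [coe_range, Set.mem_Iio] at hx hy
        have h3 : B * x ≡ B * y [MOD A] := Nat.ModEq.add_right_cancel' u hxy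
        have h4 : x ≡ y [MOD A] := Nat.ModEq.cancel_left_of_coprime hAB h3
        exact Nat.ModEq.eq_of_lt_of_lt h4 hx hy
      have im : (range A).image (fun n => (B * n + u) % A) = range A := by
        apply eq_of_subset_of_card_le
        · intro z hz
          obtain ⟨n, _, rfl⟩ := mem_image.1 hz
          exact mem_range.2 (Nat.mod_lt _ hA)
        · rw [card_image_of_injOn inj]
      conv_rhs => rw [← im, sum_image inj]
      exact sum_congr rfl fun n _ => (hc _).symm
    rw [sum_congr rfl e1, ← sum_mul, norm_mul]
    gcongr
    refine (norm_sum_le _ _).trans ((sum_le_sum fun n _ => hH1 n).trans ?_)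
    simp
  set M := B * A with hM
  have hMpos : 0 < M := Nat.mul_pos hB hA
  have hN : N = M * (N / M) + N % M := (Nat.div_add_mod N M).symm
  have hsplit : ∑ n ∈ range N, c n * H n = ∑ l ∈ range (N / M), ∑ b ∈ range M,
      c (M * l + b) * H (M * l + b) + ∑ b ∈ range (N % M),
      c (M * (N / M) + b) * H (M * (N / M) + b) := by
    conv_lhs => rw [hN]
    rw [sum_range_add, kim_sum_mul]
  rw [hsplit]
  refine (norm_add_le _ _).trans (add_le_add ?_ ?_)
  · refine (norm_sum_le _ _).trans ((sum_le_sum fun l _ => full l).trans ?_)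
    rw [sum_const, card_range, nsmul_eq_mul, ← mul_assoc]
    gcongr
    have : ((N / M : ℕ) : ℝ) ≤ (N : ℝ) / M := Nat.cast_div_le
    have hB' : (0 : ℝ) < B := by exact_mod_cast hB
    have hA' : (0 : ℝ) < A := by exact_mod_cast hA
    calc _ ≤ (N : ℝ) / M * B := by gcongr
      _ = _ := by rw [hM]; push_cast; field_simp
  · have : ∀ b ∈ range (N % M), ‖c (M * (N / M) + b) * H (M * (N / M) + b)‖ ≤ 1 := by
      intro b _
      rw [norm_mul]
      exact mul_le_one₀ (hc1 _) (norm_nonneg _) (hH1 _)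
    refine (norm_sum_le _ _).trans ((sum_le_sum this).trans ?_)
    simp only [sum_const, card_range, nsmul_eq_mul, mul_one]
    have h := (Nat.mod_lt N hMpos).le
    calc ((N % M : ℕ) : ℝ) ≤ (M : ℕ) := by exact_mod_cast h
      _ = _ := by rw [hM]; push_cast; ring


lemma kim_corr_bound (k : ℕ) (g : Fin k → ℕ → ℂ) (hg : ∀ i n, ‖g i n‖ = 1) (P : Fin k → ℕ)
    (hP : ∀ i, 0 < P i) (hmul : ∀ i n b, b < P i → g i (P i * n + b) = g i n * g i b)
    (hcop : ∀ i j, i ≠ j → Nat.Coprime (P i) (P j)) (i₀ : Fin k) (N s : ℕ) :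
    ‖kimCorr (fun n => ∏ i, g i n) N s‖ ≤
      (N : ℝ) / P i₀ * (‖kimCorr (g i₀) (P i₀) s‖) + ∏ i, (P i : ℝ) +
      ∑ i, 2 * (((N : ℝ) / P i + 1) * s) := by
  classical
  set c : Fin k → ℕ → ℂ := fun i n => g i (n + s) * conj (g i n) with hc
  set c' : Fin k → ℕ → ℂ := fun i n => c i (n % P i) with hc'
  have hcn : ∀ i n, ‖c i n‖ = 1 := by intro i n; simp [hc, hg]
  have hgood : ∀ i n, n % P i + s < P i → c i n = c' i n := by
    intro i n h
    have e1 := Nat.div_add_mod n (P i)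
    have h1 : g i (n + s) = g i (n / P i) * g i (n % P i + s) := by
      rw [← hmul i _ _ h]; congr 1; omega
    have h2 : g i n = g i (n / P i) * g i (n % P i) := by
      rw [← hmul i _ _ (by omega)]; congr 1; omega
    have h3 : g i (n / P i) * conj (g i (n / P i)) = 1 := by
      rw [Complex.mul_conj', hg]; simp
    simp only [hc, hc']
    rw [h1, h2, map_mul]
    linear_combination (g i (n % P i + s) * conj (g i (n % P i))) * h3
  have hcorr : kimCorr (fun n => ∏ i, g i n) N s = ∑ n ∈ range N, ∏ i, c i n := by
    unfold kimCorr
    refine sum_congr rfl fun n _ => ?_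
    simp only [hc]
    rw [prod_mul_distrib, map_prod]
  have hpt : ∀ n, ‖∏ i, c i n - ∏ i, c' i n‖ ≤ ∑ i, if P i ≤ n % P i + s then (2 : ℝ) else 0 := by
    intro n
    by_cases h : ∀ i, n % P i + s < P i
    · rw [prod_congr rfl fun i _ => hgood i n (h i)]
      simp only [sub_self, norm_zero]
      exact sum_nonneg fun i _ => by split_ifs <;> norm_num
    · push Not at h
      obtain ⟨i, hi⟩ := h
      have h1 : ‖∏ i, c i n - ∏ i, c' i n‖ ≤ 2 := by
        refine (norm_sub_le _ _).trans ?_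
        simp only [norm_prod, hc', hcn]
        norm_num
      refine h1.trans ?_
      have := single_le_sum (f := fun i => if P i ≤ n % P i + s then (2 : ℝ) else 0)
        (fun i _ => by split_ifs <;> norm_num) (mem_univ i)
      simpa only [if_pos hi] using this
  have hdiff : ‖∑ n ∈ range N, ∏ i, c i n - ∑ n ∈ range N, ∏ i, c' i n‖ ≤
      ∑ i, 2 * (((N : ℝ) / P i + 1) * s) := by
    rw [← sum_sub_distrib]
    refine (norm_sum_le _ _).trans ((sum_le_sum fun n _ => hpt n).trans ?_)
    rw [sum_comm]
    refine sum_le_sum fun i _ => ?_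
    rw [← sum_filter, sum_const, nsmul_eq_mul, mul_comm]
    have := kim_count N (P i) s (hP i)
    linarith
  have hmain : ‖∑ n ∈ range N, ∏ i, c' i n‖ ≤
      (N : ℝ) / P i₀ * (‖kimCorr (g i₀) (P i₀) s‖) + ∏ i, (P i : ℝ) := by
    have e : ∀ n, ∏ i, c' i n = c' i₀ n * ∏ i ∈ univ.erase i₀, c' i n := by
      intro n; rw [mul_prod_erase univ (fun i => c' i n) (mem_univ _)]
    have e2 : ∏ i, (P i : ℝ) = P i₀ * ((∏ i ∈ univ.erase i₀, P i : ℕ) : ℝ) := by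
      push_cast
      rw [mul_prod_erase univ (fun i => (P i : ℝ)) (mem_univ _)]
    simp only [e]
    rw [e2]
    have e3 : kimCorr (g i₀) (P i₀) s = ∑ x ∈ range (P i₀), c' i₀ x := by
      unfold kimCorr
      refine sum_congr rfl fun x hx => ?_
      simp only [hc', hc]
      rw [Nat.mod_eq_of_lt (mem_range.1 hx)]
    rw [e3]
    apply kim_crt (c' i₀) (fun n => ∏ i ∈ univ.erase i₀, c' i n) (P i₀)
      (∏ i ∈ univ.erase i₀, P i) (hP _) (prod_pos fun i _ => hP i)
    · exact Nat.Coprime.prod_right fun i hi => hcop _ _ (ne_of_mem_erase hi).symm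
    · intro n; simp [hc']
    · intro n
      refine prod_congr rfl fun i hi => ?_
      simp only [hc']
      rw [Nat.mod_mod_of_dvd _ (dvd_prod_of_mem P hi)]
    · intro n; exact (hcn _ _).le
    · intro n; simp [hc', hcn]
  rw [hcorr]
  have := norm_le_norm_add_norm_sub' (∑ n ∈ range N, ∏ i, c i n) (∑ n ∈ range N, ∏ i, c' i n)
  linarith

set_option maxHeartbeats 1000000 in
lemma kim_bad_aux (k : ℕ) (hk : 0 < k) (q : Fin k → ℕ) (hq : ∀ i, 2 ≤ q i)
    (hcop : ∀ i j, i ≠ j → Nat.Coprime (q i) (q j))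
    (g : Fin k → ℕ → ℂ) (hg : ∀ i n, ‖g i n‖ = 1)
    (hmul : ∀ i t n b, b < q i ^ t → g i (q i ^ t * n + b) = g i n * g i b)
    (i₀ : Fin k) (e : ℕ) (he : e = 1 ∨ e = 2) (Q : ℕ) (hQ : Q = q i₀ ^ e)
    (ρ : ℝ) (s₀ : ℕ) (hs₀ : s₀ < Q) (hρ : 3 / 4 ≤ ρ) (hρ1 : ρ ≤ 1)
    (hsav : ‖kimCorr (g i₀) (Q - s₀) s₀‖ ≤ (Q : ℝ) - s₀ - ((Q : ℝ) ^ 2 - (Q : ℝ) ^ 2 * ρ))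
    (N j : ℕ) (hN : 0 < N) (hj : Q ^ (4 * k * j) ≤ N) :
    ‖∑ n ∈ range N, ∏ i, g i n‖ ^ 2 ≤ (36 + 8 * ∑ i, ((q i : ℝ) + 1)) * (N : ℝ) ^ 2 * ρ ^ j := by
  have hQ2 : 2 ≤ Q := by
    rw [hQ]; exact (hq i₀).trans (Nat.le_self_pow (by omega) _)
  set R := Q ^ j with hR
  set X := R ^ 2 with hX
  have hRpos : 0 < R := by positivity
  have hXpos : 0 < X := by positivity
  have hXN : (X ^ k) ^ 2 ≤ N := by
    refine le_trans (le_of_eq ?_) hj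
    rw [hX, hR]; simp only [← pow_mul]; congr 1; ring
  have hXi : X = q i₀ ^ (e * (j * 2)) := by
    rw [hX, hR, hQ]; simp only [← pow_mul]; congr 1; ring
  set t : Fin k → ℕ := fun i => Nat.log (q i) X with ht
  set P : Fin k → ℕ := fun i => q i ^ t i with hPdef
  have hPpos : ∀ i, 0 < P i := fun i => pow_pos (by have := hq i; omega) _
  have hP0 : P i₀ = X := by
    simp only [hPdef, ht]
    rw [hXi, Nat.log_pow (by have := hq i₀; omega)]
  have hPX : ∀ i, P i ≤ X := fun i => Nat.pow_log_le_self _ hXpos.ne'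
  have hXP : ∀ i, X ≤ q i * P i := by
    intro i
    have := (Nat.lt_pow_succ_log_self (b := q i) (by have := hq i; omega) X).le
    rwa [pow_succ, mul_comm] at this
  -- real versions
  have hNr : (0 : ℝ) < N := by exact_mod_cast hN
  have hRr : (1 : ℝ) ≤ R := by exact_mod_cast hRpos
  have hXr : (X : ℝ) = (R : ℝ) ^ 2 := by rw [hX]; push_cast; ring
  have hXk : (R : ℝ) ^ 2 ≤ (X : ℝ) ^ k := by
    rw [← hXr]
    exact le_self_pow₀ (by rw [hXr]; nlinarith) hk.ne'
  have hXNr : ((X : ℝ) ^ k) ^ 2 ≤ N := by exact_mod_cast hXN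
  have hX1 : (0 : ℝ) < (X : ℝ) ^ k := by positivity
  have hR4 : (R : ℝ) ^ 4 ≤ N := by nlinarith
  have hR2N : (R : ℝ) ^ 2 ≤ N := (pow_le_pow_right₀ hRr (by norm_num)).trans hR4
  have hRN : (R : ℝ) ≤ N := (le_self_pow₀ hRr (by norm_num)).trans hR4
  have hprodP : ∏ i, (P i : ℝ) ≤ (X : ℝ) ^ k := by
    calc _ ≤ ∏ i : Fin k, (X : ℝ) := by
          apply prod_le_prod
          · intro i _; positivity
          · intro i _; exact_mod_cast hPX i
      _ = _ := by simp
  have hprodR : (R : ℝ) ^ 2 * ∏ i, (P i : ℝ) ≤ N := by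
    calc _ ≤ (X : ℝ) ^ k * (X : ℝ) ^ k := by gcongr
      _ ≤ N := by rw [← sq]; exact hXNr
  -- average
  have havg := kim_avg (g i₀) (hg i₀) Q hQ2 (by
      intro n b hb; rw [hQ] at hb ⊢; exact hmul i₀ e n b hb) ((Q : ℝ) ^ 2 * ρ) s₀ hs₀ hsav
      (by nlinarith [sq_nonneg (Q : ℝ)]) R j
  rw [← hR] at havg
  have hRR : R * R = X := by rw [hX, sq]
  rw [hRR] at havg
  have hQj : ((Q : ℝ) ^ 2 * ρ) ^ j = (R : ℝ) ^ 2 * ρ ^ j := by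
    rw [mul_pow, hR]; push_cast; ring
  have hQj' : (Q : ℝ) ^ j = R := by rw [hR]; push_cast; ring
  rw [hQj, hQj'] at havg
  have hρj : 0 ≤ ρ ^ j := by positivity
  have havg' : ∑ r ∈ range R, ‖kimCorr (g i₀) X r‖ ≤ 5 * (R : ℝ) ^ 3 * ρ ^ j := by
    nlinarith
  have hinv : 1 ≤ R * ρ ^ j := by
    rw [← hQj', ← mul_pow]
    apply one_le_pow₀
    have : (2 : ℝ) ≤ Q := by exact_mod_cast hQ2
    nlinarith
  -- correlation sums
  set D := ∑ i, ((q i : ℝ) + 1) with hD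
  have hD0 : 0 ≤ D := sum_nonneg fun i _ => by positivity
  have hC : ∑ s ∈ range R, ‖kimCorr (fun n => ∏ i, g i n) N s‖ ≤
      5 * N * R * ρ ^ j + N / R + 2 * N * D := by
    have hb : ∀ s ∈ range R, ‖kimCorr (fun n => ∏ i, g i n) N s‖ ≤
        (N : ℝ) / (R : ℝ) ^ 2 * ‖kimCorr (g i₀) X s‖ + N / (R : ℝ) ^ 2 + 2 * N * D / R := by
      intro s hs
      rw [mem_range] at hs
      have hsR : (s : ℝ) ≤ R := by exact_mod_cast hs.le
      have h1 := kim_corr_bound k g hg P hPpos (fun i => hmul i (t i))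
        (fun i j hij => Nat.Coprime.pow _ _ (hcop i j hij)) i₀ N s
      rw [hP0, hXr] at h1
      have h2 : ∏ i, (P i : ℝ) ≤ N / (R : ℝ) ^ 2 := by
        rw [le_div_iff₀ (by positivity)]; linarith
      have h3 : ∑ i, 2 * (((N : ℝ) / P i + 1) * s) ≤ 2 * N * D / R := by
        rw [hD, mul_sum, sum_div]
        refine sum_le_sum fun i _ => ?_
        have hPi : (0 : ℝ) < P i := by exact_mod_cast hPpos i
        have h4 : (N : ℝ) / P i ≤ N * q i / (R : ℝ) ^ 2 := by
          rw [div_le_div_iff₀ hPi (by positivity)]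
          have : (R : ℝ) ^ 2 ≤ q i * P i := by rw [← hXr]; exact_mod_cast hXP i
          nlinarith
        have h5 : (1 : ℝ) ≤ N / (R : ℝ) ^ 2 := by
          rw [le_div_iff₀ (by positivity)]; linarith
        calc 2 * (((N : ℝ) / P i + 1) * s) ≤
            2 * ((N * q i / (R : ℝ) ^ 2 + N / (R : ℝ) ^ 2) * R) := by gcongr
          _ = _ := by field_simp
      linarith
    refine (sum_le_sum hb).trans ?_
    rw [sum_add_distrib, sum_add_distrib, ← mul_sum]
    simp only [sum_const, card_range, nsmul_eq_mul]
    have h6 : (N : ℝ) / (R : ℝ) ^ 2 * ∑ r ∈ range R, ‖kimCorr (g i₀) X r‖ ≤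
        (N : ℝ) / (R : ℝ) ^ 2 * (5 * (R : ℝ) ^ 3 * ρ ^ j) := by gcongr
    have h7 : (N : ℝ) / (R : ℝ) ^ 2 * (5 * (R : ℝ) ^ 3 * ρ ^ j) = 5 * N * R * ρ ^ j := by
      field_simp
    have h8 : (R : ℝ) * (N / (R : ℝ) ^ 2) = N / R := by field_simp
    have h9 : (R : ℝ) * (2 * N * D / R) = 2 * N * D :=
      mul_div_cancel₀ _ (by positivity)
    linarith
  have hv := kim_vdc (fun n => ∏ i, g i n) (by intro n; simp [hg]) N R
  set S := ‖∑ n ∈ range N, ∏ i, g i n‖ ^ 2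
  have hN1 : (N : ℝ) / R ≤ N * (R * ρ ^ j) := by
    calc (N : ℝ) / R ≤ N := div_le_self hNr.le hRr
      _ ≤ _ := le_mul_of_one_le_right hNr.le hinv
  have hC' : ∑ s ∈ range R, ‖kimCorr (fun n => ∏ i, g i n) N s‖ ≤
      (6 + 2 * D) * N * (R * ρ ^ j) := by
    have : 2 * N * D ≤ 2 * N * D * (R * ρ ^ j) := le_mul_of_one_le_right (by positivity) hinv
    linarith
  have h10 : 4 * N * R * ∑ s ∈ range R, ‖kimCorr (fun n => ∏ i, g i n) N s‖ ≤
      4 * N * R * ((6 + 2 * D) * N * (R * ρ ^ j)) := by gcongr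
  have h11 : (R : ℝ) ^ 3 ≤ N * R ^ 2 * ρ ^ j := by
    calc (R : ℝ) ^ 3 ≤ R ^ 3 * (R * ρ ^ j) := le_mul_of_one_le_right (by positivity) hinv
      _ = R ^ 2 * (R ^ 2 * ρ ^ j) := by ring
      _ ≤ N * (R ^ 2 * ρ ^ j) := by gcongr
      _ = _ := by ring
  have h12 : (R : ℝ) ^ 4 ≤ N * (N * R ^ 2 * ρ ^ j) := by
    calc (R : ℝ) ^ 4 = R * R ^ 3 := by ring
      _ ≤ N * (N * R ^ 2 * ρ ^ j) := by
        gcongr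
  have h13 : 4 * N * (R : ℝ) ^ 3 ≤ 4 * N * (N * R ^ 2 * ρ ^ j) := by gcongr
  have h14 : (R : ℝ) ^ 2 * S ≤ R ^ 2 * ((36 + 8 * D) * (N : ℝ) ^ 2 * ρ ^ j) := by
    calc _ ≤ _ := hv
      _ ≤ 4 * N * R * ((6 + 2 * D) * N * (R * ρ ^ j)) + 4 * N * (N * R ^ 2 * ρ ^ j) +
        8 * (N * (N * R ^ 2 * ρ ^ j)) := by linarith
      _ = _ := by ring
  exact le_of_mul_le_mul_left h14 (by positivity)

lemma kim_bad (k : ℕ) (hk : 0 < k) (q : Fin k → ℕ) (hq : ∀ i, 2 ≤ q i)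
    (hcop : ∀ i j, i ≠ j → Nat.Coprime (q i) (q j))
    (g : Fin k → ℕ → ℂ) (hg : ∀ i n, ‖g i n‖ = 1)
    (hmul : ∀ i t n b, b < q i ^ t → g i (q i ^ t * n + b) = g i n * g i b)
    (i₀ : Fin k) (e : ℕ) (he : e = 1 ∨ e = 2) (Q : ℕ) (hQ : Q = q i₀ ^ e)
    (κ : ℝ) (s₀ : ℕ) (hs₀ : s₀ < Q) (hκ : 0 ≤ κ) (hκ1 : κ ≤ 1 / 4)
    (hsav : ‖kimCorr (g i₀) (Q - s₀) s₀‖ ≤ (Q : ℝ) - s₀ - (Q : ℝ) ^ 2 * κ)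
    (δ : ℝ) (hδ : 0 ≤ δ) (hδκ : 16 * k * δ * q i₀ ≤ κ) :
    ∃ C : ℝ, ∀ N : ℕ, 0 < N → ‖∑ n ∈ range N, ∏ i, g i n‖ ≤ C * (N : ℝ) ^ (1 - δ) := by
  have hQ2 : 2 ≤ Q := by
    rw [hQ]; exact (hq i₀).trans (Nat.le_self_pow (by omega) _)
  set D := (36 + 8 * ∑ i, ((q i : ℝ) + 1)) with hD
  have hD0 : 0 ≤ D := by positivity
  refine ⟨Real.sqrt (D * Real.exp κ), fun N hN => ?_⟩
  have hNr : (0 : ℝ) < N := by exact_mod_cast hN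
  set j := Nat.log (Q ^ (4 * k)) N with hj
  have hQk : 1 < Q ^ (4 * k) := Nat.one_lt_pow (by omega) (by omega)
  have h1 : Q ^ (4 * k * j) ≤ N := by
    rw [pow_mul]; exact Nat.pow_log_le_self _ hN.ne'
  have h2 : N ≤ Q ^ (4 * k * (j + 1)) := by
    rw [pow_mul]; exact (Nat.lt_pow_succ_log_self hQk N).le
  have hmain := kim_bad_aux k hk q hq hcop g hg hmul i₀ e he Q hQ (1 - κ) s₀ hs₀ (by linarith)
    (by linarith) (by
      refine hsav.trans (le_of_eq ?_); ring) N j hN h1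
  rw [← hD] at hmain
  have hlogN : Real.log N ≤ 8 * k * (j + 1) * q i₀ := by
    have hq0 : (0 : ℝ) < q i₀ := by have := hq i₀; exact_mod_cast (by omega : 0 < q i₀)
    have h3 : N ≤ q i₀ ^ (8 * k * (j + 1)) := by
      refine h2.trans ?_
      rw [hQ, ← pow_mul]
      apply Nat.pow_le_pow_right (by have := hq i₀; omega)
      have : e ≤ 2 := by omega
      calc e * (4 * k * (j + 1)) ≤ 2 * (4 * k * (j + 1)) := by gcongr
        _ = _ := by ring
    have h3' : (N : ℝ) ≤ (q i₀ : ℝ) ^ (8 * k * (j + 1)) := by exact_mod_cast h3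
    calc Real.log N ≤ Real.log ((q i₀ : ℝ) ^ (8 * k * (j + 1))) := Real.log_le_log hNr h3'
      _ = 8 * k * (j + 1) * Real.log (q i₀) := by rw [Real.log_pow]; push_cast; ring
      _ ≤ _ := by
        gcongr
        have := Real.log_le_sub_one_of_pos hq0
        linarith
  have hρ : (1 - κ) ^ j ≤ Real.exp κ * (N : ℝ) ^ (-(2 * δ)) := by
    have h4 : 1 - κ ≤ Real.exp (-κ) := by
      have := Real.add_one_le_exp (-κ); linarith
    calc (1 - κ) ^ j ≤ (Real.exp (-κ)) ^ j := by
          gcongr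
          linarith
      _ = Real.exp (j * (-κ)) := by rw [Real.exp_nat_mul]
      _ ≤ Real.exp (κ + Real.log N * (-(2 * δ))) := by
          apply Real.exp_le_exp.2
          have h5 : Real.log N * (2 * δ) ≤ 8 * k * (j + 1) * q i₀ * (2 * δ) := by gcongr
          have h6 : (16 * k * δ * q i₀) * ((j : ℝ) + 1) ≤ κ * ((j : ℝ) + 1) := by gcongr
          linarith
      _ = _ := by rw [Real.exp_add, Real.rpow_def_of_pos hNr]
  have hfin : ‖∑ n ∈ range N, ∏ i, g i n‖ ^ 2 ≤
      (Real.sqrt (D * Real.exp κ) * (N : ℝ) ^ (1 - δ)) ^ 2 := by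
    rw [mul_pow, Real.sq_sqrt (by positivity)]
    have h7 : ((N : ℝ) ^ (1 - δ)) ^ 2 = (N : ℝ) ^ 2 * (N : ℝ) ^ (-(2 * δ)) := by
      rw [← Real.rpow_natCast, ← Real.rpow_mul hNr.le, ← Real.rpow_natCast (N : ℝ) 2,
        ← Real.rpow_add hNr]
      congr 1; push_cast; ring
    rw [h7]
    calc _ ≤ _ := hmain
      _ ≤ D * (N : ℝ) ^ 2 * (Real.exp κ * (N : ℝ) ^ (-(2 * δ))) := by gcongr
      _ = _ := by ring
  exact (sq_le_sq₀ (norm_nonneg _) (by positivity)).1 hfin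


lemma kim_ne_pair (a b : ℂ) (m : ℕ) (hm : 2 ≤ m) (ha : ‖a‖ = 1) (hb : ‖b‖ = 1) (ham : a ^ m = 1)
    (hbm : b ^ m = 1) (hab : a ≠ b) : ‖a + b‖ ≤ 2 - 1 / (m : ℝ) ^ 2 := by
  have ha0 : a ≠ 0 := by intro h; simp [h] at ha
  have h := kim_root_gap (b / a) m hm (by rw [div_pow, ham, hbm, div_one])
    (by intro h; exact hab ((div_eq_one_iff_eq ha0).1 h).symm) (by rw [norm_div, ha, hb, div_one])
  have e : a + b = a * (1 + b / a) := by field_simp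
  rw [e, norm_mul, ha, one_mul]
  exact h

lemma kim_saving (g : ℕ → ℂ) (q m : ℕ) (hq : 2 ≤ q) (hm : 2 ≤ m) (hg : ∀ n, ‖g n‖ = 1)
    (hgm : ∀ n, g n ^ m = 1) (g0 : g 0 = 1)
    (hmul : ∀ n b, b < q → g (q * n + b) = g n * g b)
    (hnl : ¬ ((∀ r < q, g r = g 1 ^ r) ∧ g 1 ^ (q - 1) = 1)) :
    ∃ e : ℕ, (e = 1 ∨ e = 2) ∧ ∃ s₀ < q ^ e, ‖kimCorr g (q ^ e - s₀) s₀‖ ≤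
      ((q ^ e : ℕ) : ℝ) - s₀ - ((q ^ e : ℕ) : ℝ) ^ 2 * (1 / (6 * (q : ℝ) ^ 2 * (m : ℝ) ^ 2)) := by
  have hqr : (2 : ℝ) ≤ q := by exact_mod_cast hq
  have hmr : (2 : ℝ) ≤ m := by exact_mod_cast hm
  have hcm : ∀ n, conj (g n) * g n = 1 := by
    intro n; rw [mul_comm, Complex.mul_conj', hg]; simp
  have hu1 : ∀ s b, ‖g (b + s) * conj (g b)‖ = 1 := by intro s b; simp [hg]
  have hum : ∀ s b, (g (b + s) * conj (g b)) ^ m = 1 := by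
    intro s b; rw [mul_pow, ← map_pow, hgm, hgm]; simp
  by_cases hlin : ∀ r < q, g r = g 1 ^ r
  · have hz : g 1 ^ (q - 1) ≠ 1 := fun h => hnl ⟨hlin, h⟩
    refine ⟨2, Or.inr rfl, q / 2, ?_, ?_⟩
    · calc q / 2 < q := by omega
        _ ≤ q ^ 2 := Nat.le_self_pow (by norm_num) _
    set s := q / 2 with hs
    have hsq : s < q ^ 2 := by
      calc s < q := by omega
        _ ≤ q ^ 2 := Nat.le_self_pow (by norm_num) _
    have hidx : ∀ x y : ℕ, x < q - 1 → y < q → q * x + y < q ^ 2 - s := by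
      intro x y hx hy
      have h1 : q * (x + 2) ≤ q * q := Nat.mul_le_mul_left q (by omega)
      have h2 : q * (x + 2) = q * x + 2 * q := by ring
      have h3 : q ^ 2 = q * q := by ring
      omega
    have hinj : ∀ x y x' y' : ℕ, y < q → y' < q → q * x + y = q * x' + y' → x = x' ∧ y = y' := by
      intro x y x' y' hy hy' h
      have h1 : (q * x + y) % q = (q * x' + y') % q := by rw [h]
      rw [Nat.mul_add_mod, Nat.mul_add_mod, Nat.mod_eq_of_lt hy, Nat.mod_eq_of_lt hy'] at h1
      subst h1
      have h2 : q * x = q * x' := by omega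
      exact ⟨Nat.eq_of_mul_eq_mul_left (by omega) h2, rfl⟩
    have hp := kim_pair (range (q ^ 2 - s)) (fun b => g (b + s) * conj (g b))
      (fun b => (hu1 s b).le) (range (q - 1) ×ˢ range s)
      (fun p => q * p.1 + p.2) (fun p => q * p.1 + (q - s + p.2))
      (by
        rintro ⟨x, y⟩ h
        simp only [mem_product, mem_range] at h ⊢
        exact hidx x y h.1 (by omega))
      (by
        rintro ⟨x, y⟩ h
        simp only [mem_product, mem_range] at h ⊢
        exact hidx x _ h.1 (by omega))
      (by
        rintro ⟨x, y⟩ h ⟨x', y'⟩ h' hh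
        simp only [coe_product, coe_range, Set.mem_prod, Set.mem_Iio] at h h' hh
        have := hinj x y x' y' (by omega) (by omega) hh
        rw [Prod.mk.injEq]; exact this)
      (by
        rintro ⟨x, y⟩ h ⟨x', y'⟩ h' hh
        simp only [coe_product, coe_range, Set.mem_prod, Set.mem_Iio] at h h' hh
        have := hinj x _ x' _ (by omega) (by omega) hh
        rw [Prod.mk.injEq]; omega)
      (by
        rintro ⟨x, y⟩ h ⟨x', y'⟩ h' hh
        simp only [mem_product, mem_range] at h h' hh
        have := hinj x y x' _ (by omega) (by omega) hh
        omega)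
      (1 / (m : ℝ) ^ 2)
      (by
        rintro ⟨x, y⟩ h
        simp only [mem_product, mem_range] at h
        obtain ⟨hx, hy⟩ := h
        refine kim_ne_pair _ _ m hm (hu1 _ _) (hu1 _ _) (hum _ _) (hum _ _) ?_
        intro heq
        dsimp only at heq
        have e1 : q * x + y + s = q * x + (y + s) := by ring
        have e2 : q * x + (q - s + y) + s = q * (x + 1) + y := by
          have : q * (x + 1) = q * x + q := by ring
          omega
        rw [e1, e2, hmul _ _ (by omega), hmul _ _ (by omega), hmul _ _ (by omega),
          hmul _ _ (by omega), map_mul, map_mul] at heq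
        have c1 := hcm x
        have c2 := hcm y
        have c3 := hcm (q - s + y)
        have k1 : g (y + s) = g 1 ^ s * g y := by
          rw [hlin _ (by omega), hlin y (by omega), pow_add, mul_comm]
        have k2 : g (x + 1) = g 1 * g x := by
          rw [hlin _ (by omega), hlin x (by omega), pow_succ, mul_comm]
        have k3 : g (q - s + y) = g 1 ^ (q - s) * g y := by
          rw [hlin _ (by omega), hlin y (by omega), pow_add]
        rw [k1, k2] at heq
        have l1 : g 1 ^ s = g 1 * (g y * conj (g (q - s + y))) := by
          linear_combination heq - g 1 ^ s * c1 * (conj (g y) * g y) - g 1 ^ s * c2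
            + g 1 * g y * conj (g (q - s + y)) * c1
        have l2 : g 1 ^ s * g 1 ^ (q - s) * g y = g 1 * g y := by
          rw [mul_assoc, ← k3]
          linear_combination g (q - s + y) * l1 + g 1 * g y * c3
        have l3 : g 1 * g y ≠ 0 := by
          apply mul_ne_zero <;> (intro h0; have := hg 1; have := hg y; simp_all)
        apply hz
        have l4 : g 1 ^ s * g 1 ^ (q - s) = g 1 * g 1 ^ (q - 1) := by
          rw [← pow_add, ← pow_succ']; congr 1; omega
        rw [l4] at l2
        apply mul_left_cancel₀ l3
        linear_combination l2)
    unfold kimCorr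
    refine hp.trans ?_
    rw [card_range, card_product, card_range, card_range, Nat.cast_sub hsq.le]
    have hcount : (q : ℝ) ^ 2 / 6 ≤ ((q - 1) * s : ℕ) := by
      have h1 : q ^ 2 ≤ 6 * ((q - 1) * s) := by
        obtain ⟨p, rfl⟩ : ∃ p, q = p + 2 := ⟨q - 2, by omega⟩
        have h2 : p + 2 - 1 = p + 1 := by omega
        have h3 : p + 1 ≤ 2 * s := by omega
        rw [h2]
        rcases Nat.eq_zero_or_pos p with h | h
        · subst h; simp [hs]
        · nlinarith
      have : (q : ℝ) ^ 2 ≤ 6 * ((q - 1) * s : ℕ) := by exact_mod_cast h1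
      linarith
    have h2 : (q : ℝ) ^ 2 / 6 * (1 / (m : ℝ) ^ 2) ≤ ((q - 1) * s : ℕ) * (1 / (m : ℝ) ^ 2) := by
      gcongr
    have h3 : (((q ^ 2 : ℕ) : ℝ)) ^ 2 * (1 / (6 * (q : ℝ) ^ 2 * (m : ℝ) ^ 2)) =
        (q : ℝ) ^ 2 / 6 * (1 / (m : ℝ) ^ 2) := by
      push_cast; field_simp
    rw [h3]
    linarith
  · have hex : ∃ b < q - 1, g (b + 1) * conj (g b) ≠ g 1 := by
      by_contra hcon
      push Not at hcon
      apply hlin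
      intro r
      induction r with
      | zero => intro _; simp [g0]
      | succ r ih =>
        intro hr
        have h1 := hcon r (by omega)
        have h2 := hcm r
        have h3 := ih (by omega)
        rw [pow_succ, ← h3]
        linear_combination g r * h1 - g (r + 1) * h2
    obtain ⟨b, hb, hne⟩ := hex
    refine ⟨1, Or.inl rfl, 1, by rw [pow_one]; omega, ?_⟩
    rw [pow_one]
    have hb0 : b ≠ 0 := by
      rintro rfl
      simp [g0] at hne
    have hp := kim_pair (range (q - 1)) (fun b => g (b + 1) * conj (g b))
      (fun b => (hu1 1 b).le) ({()} : Finset Unit) (fun _ => 0) (fun _ => b)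
      (by intro _ _; rw [mem_range]; omega) (by intro _ _; rw [mem_range]; omega)
      (by intro x _ y _ _; rfl) (by intro x _ y _ _; rfl) (by intro _ _ _ _; exact hb0.symm)
      (1 / (m : ℝ) ^ 2)
      (by
        intro _ _
        refine kim_ne_pair _ _ m hm (hu1 _ _) (hu1 _ _) (hum _ _) (hum _ _) ?_
        intro h
        apply hne
        rw [← h]
        simp [g0])
    unfold kimCorr
    refine hp.trans ?_
    rw [card_range, Nat.cast_sub (by omega)]
    have h3 : (q : ℝ) ^ 2 * (1 / (6 * (q : ℝ) ^ 2 * (m : ℝ) ^ 2)) = 1 / (m : ℝ) ^ 2 / 6 := by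
      field_simp
    rw [h3]
    have : 0 ≤ 1 / (m : ℝ) ^ 2 := by positivity
    simp only [card_singleton, Nat.cast_one]
    linarith

lemma kim_linear (g : ℕ → ℂ) (q : ℕ) (hq : 2 ≤ q)
    (hmul : ∀ n b, b < q → g (q * n + b) = g n * g b)
    (h1 : ∀ r < q, g r = g 1 ^ r) (h2 : g 1 ^ (q - 1) = 1) (n : ℕ) : g n = g 1 ^ n := by
  induction n using Nat.strong_induction_on with
  | _ n ih =>
    rcases lt_or_ge n q with h | h
    · exact h1 n h
    · have e := Nat.div_add_mod n q
      have hlt : n / q < n := Nat.div_lt_self (by omega) (by omega)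
      have hmod : n % q < q := Nat.mod_lt _ (by omega)
      have hzq : g 1 ^ q = g 1 := by
        have : q = (q - 1) + 1 := by omega
        rw [this, pow_succ, h2, one_mul]
      calc g n = g (q * (n / q) + n % q) := by rw [e]
        _ = g 1 ^ (n / q) * g 1 ^ (n % q) := by rw [hmul _ _ hmod, ih _ hlt, h1 _ hmod]
        _ = g 1 ^ (q * (n / q) + n % q) := by rw [pow_add, pow_mul, hzq]
        _ = g 1 ^ n := by rw [e]

lemma kim_coprime_roots {ι : Type*} [Fintype ι] (z : ι → ℂ) (d : ι → ℕ)
    (hz : ∀ i, z i ^ d i = 1) (hd : ∀ i j, i ≠ j → Nat.Coprime (d i) (d j))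
    (hp : ∏ i, z i = 1) (i : ι) : z i = 1 := by
  classical
  set D := ∏ j ∈ univ.erase i, d j with hD
  have hco : Nat.Coprime (d i) D :=
    Nat.Coprime.prod_right fun j hj => hd _ _ (ne_of_mem_erase hj).symm
  have h1 : z i ^ D = 1 := by
    have h2 : (∏ j, z j) ^ D = 1 := by rw [hp, one_pow]
    rw [← mul_prod_erase univ z (mem_univ i), mul_pow, ← prod_pow] at h2
    have h3 : ∏ j ∈ univ.erase i, z j ^ D = 1 := by
      apply prod_eq_one
      intro j hj
      obtain ⟨c, hc⟩ := dvd_prod_of_mem d hj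
      rw [hD, hc, pow_mul, hz, one_pow]
    rwa [h3, mul_one] at h2
  have h4 : orderOf (z i) ∣ Nat.gcd (d i) D :=
    Nat.dvd_gcd (orderOf_dvd_of_pow_eq_one (hz i)) (orderOf_dvd_of_pow_eq_one h1)
  rw [hco] at h4
  exact orderOf_eq_one_iff.1 (Nat.dvd_one.1 h4)

lemma kim_geom (Z : ℂ) (hZ : Z ≠ 1) (hn : ‖Z‖ = 1) (δ : ℝ) (hδ : δ ≤ 1) :
    ∃ C : ℝ, ∀ N : ℕ, 0 < N → ‖∑ n ∈ range N, Z ^ n‖ ≤ C * (N : ℝ) ^ (1 - δ) := by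
  refine ⟨2 / ‖Z - 1‖, fun N hN => ?_⟩
  have h1 : ‖∑ n ∈ range N, Z ^ n‖ ≤ 2 / ‖Z - 1‖ := by
    rw [geom_sum_eq hZ, norm_div]
    gcongr
    refine (norm_sub_le _ _).trans ?_
    rw [norm_pow, hn]; norm_num
  refine h1.trans (le_mul_of_one_le_right (by positivity) ?_)
  exact Real.one_le_rpow (by exact_mod_cast hN) (by linarith)

lemma kim_gcd2 {m : ℕ} (h : ZMod m) (x y : ℤ) (hx : h * (x : ZMod m) = 0)
    (hy : h * (y : ZMod m) = 0) : h * (((Int.gcd x y : ℕ) : ℤ) : ZMod m) = 0 := by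
  rw [Int.gcd_eq_gcd_ab]
  push_cast
  linear_combination (Int.gcdA x y : ZMod m) * hx + (Int.gcdB x y : ZMod m) * hy

lemma kim_gcdS {m : ℕ} (h : ZMod m) (S : Finset ℕ) (F : ℕ → ℤ)
    (hS : ∀ r ∈ S, h * ((F r : ℤ) : ZMod m) = 0) : h * ((S.gcd F : ℤ) : ZMod m) = 0 := by
  classical
  induction S using Finset.induction_on with
  | empty => simp
  | insert a S ha ih =>
    rw [gcd_insert, ← Int.coe_gcd]
    exact kim_gcd2 h _ _ (hS a (mem_insert_self _ _))
      (ih fun r hr => hS r (mem_insert_of_mem hr))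

end KimAux

open Finset ComplexConjugate in
lemma kim_expsum (k : ℕ) (hk : 0 < k) (q m : Fin k → ℕ) (f : Fin k → ℕ → ℤ)
    [∀ i, NeZero (m i)]
    (hq : ∀ i, 2 ≤ q i)
    (hqcop : ∀ i j, i ≠ j → Nat.Coprime (q i) (q j))
    (hm : ∀ i, 2 ≤ m i)
    (hf0 : ∀ i, f i 0 = 0)
    (hfadd : ∀ i, ∀ a s b : ℕ, 1 ≤ a → 1 ≤ s → b < q i ^ s →
      f i (a * q i ^ s + b) = f i a + f i b)
    (F : Fin k → ℤ) (hF : ∀ i, F i = f i 1)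
    (d : Fin k → ℕ)
    (hd : ∀ i, (d i : ℤ) = Int.gcd ((m i : ℤ))
      (Int.gcd (((q i : ℤ) - 1) * F i)
        ((Finset.Icc 2 (q i - 1)).gcd (fun r : ℕ => f i r - (r : ℤ) * F i))))
    (hFd : ∀ i, Int.gcd (F i) ((d i : ℤ)) = 1)
    (hdd : ∀ i j, i ≠ j → Nat.Coprime (d i) (d j))
    (δ : ℝ) (hδ : δ = 1 / (120 * (k : ℝ) ^ 2 * ((Finset.univ.sup q : ℕ) : ℝ) ^ 3 *
            ((Finset.univ.sup m : ℕ) : ℝ) ^ 2))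
    (h : ∀ i, ZMod (m i)) (hh : h ≠ 0) :
    ∃ C : ℝ, ∀ N : ℕ, 0 < N →
      ‖∑ n ∈ range N, ∏ i, ZMod.stdAddChar (h i * ((f i n : ℤ) : ZMod (m i)))‖ ≤
        C * (N : ℝ) ^ (1 - δ) := by
  set M : ℕ := Finset.univ.sup m with hM
  set q' : ℕ := Finset.univ.sup q with hq'
  have hmM : ∀ i, (m i : ℝ) ≤ M := fun i => by exact_mod_cast Finset.le_sup (f := m) (mem_univ i)
  have hqQ : ∀ i, (q i : ℝ) ≤ q' := fun i => by exact_mod_cast Finset.le_sup (f := q) (mem_univ i)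
  have hkr : (1 : ℝ) ≤ k := by exact_mod_cast hk
  have hmr : ∀ i, (2 : ℝ) ≤ m i := fun i => by exact_mod_cast hm i
  have hqr : ∀ i, (2 : ℝ) ≤ q i := fun i => by exact_mod_cast hq i
  have hM2 : (2 : ℝ) ≤ M := (hmr ⟨0, hk⟩).trans (hmM _)
  have hQ2 : (2 : ℝ) ≤ q' := (hqr ⟨0, hk⟩).trans (hqQ _)
  have hδ0 : 0 ≤ δ := by rw [hδ]; positivity
  have hδ1 : δ ≤ 1 := by
    rw [hδ, div_le_one (by positivity)]
    have h1 : (1 : ℝ) ≤ (k : ℝ) ^ 2 := one_le_pow₀ hkr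
    have h2 : (1 : ℝ) ≤ (q' : ℝ) ^ 3 := one_le_pow₀ (by linarith)
    have h3 : (1 : ℝ) ≤ (M : ℝ) ^ 2 := one_le_pow₀ (by linarith)
    calc (1 : ℝ) ≤ 120 * 1 * 1 * 1 := by norm_num
      _ ≤ _ := by gcongr
  set g : Fin k → ℕ → ℂ := fun i n => ZMod.stdAddChar (h i * ((f i n : ℤ) : ZMod (m i))) with hgdef
  have hg : ∀ i n, ‖g i n‖ = 1 := by
    intro i n; simp only [hgdef, ZMod.stdAddChar_apply]; exact Circle.norm_coe _
  have hg0 : ∀ i, g i 0 = 1 := by intro i; simp [hgdef, hf0]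
  have hpow : ∀ i n (l : ℕ), g i n ^ l =
      ZMod.stdAddChar (h i * (((l : ℤ) * f i n : ℤ) : ZMod (m i))) := by
    intro i n l
    simp only [hgdef]
    rw [← AddChar.map_nsmul_eq_pow, nsmul_eq_mul]
    congr 1; push_cast; ring
  have hgm : ∀ i n, g i n ^ m i = 1 := by
    intro i n; rw [hpow]; simp
  have hone : ∀ i (x : ZMod (m i)), ZMod.stdAddChar x = (1 : ℂ) → x = 0 := by
    intro i x hx
    apply ZMod.injective_stdAddChar
    rw [hx, AddChar.map_zero_eq_one]
  have hmul : ∀ i t n b, b < q i ^ t → g i (q i ^ t * n + b) = g i n * g i b := by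
    intro i t n b hb
    have : f i (q i ^ t * n + b) = f i n + f i b := by
      rcases Nat.eq_zero_or_pos n with rfl | hn
      · simp [hf0]
      rcases Nat.eq_zero_or_pos t with rfl | ht
      · have : b = 0 := by simpa using hb
        subst this
        simp [hf0]
      rw [mul_comm]; exact hfadd i n t b hn ht hb
    simp only [hgdef]
    rw [this, ← AddChar.map_add_eq_mul]
    congr 1; push_cast; ring
  have hmul1 : ∀ i n b, b < q i → g i (q i * n + b) = g i n * g i b := by
    intro i n b hb
    have := hmul i 1 n b (by simpa using hb)
    simpa using this
  by_cases hall : ∀ i, (∀ r < q i, g i r = g i 1 ^ r) ∧ g i 1 ^ (q i - 1) = 1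
  · have hlin : ∀ i n, g i n = g i 1 ^ n := fun i n =>
      kim_linear (g i) (q i) (hq i) (hmul1 i) (hall i).1 (hall i).2 n
    have hhd : ∀ i, h i * (((d i : ℕ) : ℤ) : ZMod (m i)) = 0 := by
      intro i
      rw [hd i]
      apply kim_gcd2
      · simp
      apply kim_gcd2
      · have h1 := (hall i).2
        rw [hpow] at h1
        have h2 := hone i _ h1
        rw [Nat.cast_sub (by have := hq i; omega)] at h2
        rw [hF]; simpa using h2
      · apply kim_gcdS
        intro r hr
        rw [mem_Icc] at hr
        have h1 := (hall i).1 r (by omega)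
        rw [hpow] at h1
        have h2 := ZMod.injective_stdAddChar h1
        rw [hF]
        rw [Int.cast_sub, mul_sub, h2, sub_self]
    have hZ : ∏ i, g i 1 ≠ 1 := by
      intro hp
      apply hh
      funext i
      have h1 := kim_coprime_roots (fun i => g i 1) d (by
        intro i
        rw [hpow]
        have : h i * (((d i : ℤ) * f i 1 : ℤ) : ZMod (m i)) = 0 := by
          rw [Int.cast_mul, ← mul_assoc, hhd i, zero_mul]
        rw [this, AddChar.map_zero_eq_one]) hdd hp i
      have h2 : h i * ((F i : ℤ) : ZMod (m i)) = 0 := by rw [hF]; exact hone i _ h1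
      have h3 := kim_gcd2 (h i) _ _ h2 (hhd i)
      rw [hFd i] at h3
      simpa using h3
    obtain ⟨C, hC⟩ := kim_geom (∏ i, g i 1) hZ (by simp [hg]) δ hδ1
    refine ⟨C, fun N hN => ?_⟩
    have e : ∀ n, ∏ i, ZMod.stdAddChar (h i * ((f i n : ℤ) : ZMod (m i))) =
        (∏ i, g i 1) ^ n := by
      intro n
      rw [← prod_pow]
      exact prod_congr rfl fun i _ => hlin i n
    simp only [e]
    exact hC N hN
  · push Not at hall
    obtain ⟨i₀, hi₀⟩ := hall
    obtain ⟨e, he, s₀, hs₀, hsav⟩ := kim_saving (g i₀) (q i₀) (m i₀) (hq i₀) (hm i₀) (hg i₀)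
      (hgm i₀) (hg0 i₀) (hmul1 i₀) (fun hc => hi₀ hc.1 hc.2)
    have hq2 := hqr i₀
    have hm2 := hmr i₀
    refine kim_bad k hk q hq hqcop g hg hmul i₀ e he _ rfl _ s₀ hs₀ (by positivity) ?_ hsav δ hδ0 ?_
    · apply one_div_le_one_div_of_le (by norm_num)
      have h2 : (1 : ℝ) ≤ (q i₀ : ℝ) ^ 2 := one_le_pow₀ (by linarith)
      have h3 : (1 : ℝ) ≤ (m i₀ : ℝ) ^ 2 := one_le_pow₀ (by linarith)
      calc (4 : ℝ) ≤ 6 * 1 * 1 := by norm_num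
        _ ≤ _ := by gcongr
    · have h1 : δ ≤ 1 / (120 * (k : ℝ) * (q i₀ : ℝ) ^ 3 * (m i₀ : ℝ) ^ 2) := by
        rw [hδ]
        apply one_div_le_one_div_of_le (by positivity)
        have h5 : (k : ℝ) ≤ (k : ℝ) ^ 2 := le_self_pow₀ hkr (by norm_num)
        have := hmM i₀
        have := hqQ i₀
        gcongr
      calc 16 * k * δ * q i₀ ≤
          16 * k * (1 / (120 * (k : ℝ) * (q i₀ : ℝ) ^ 3 * (m i₀ : ℝ) ^ 2)) * q i₀ := by gcongr
        _ = (16 / 120) * (1 / ((q i₀ : ℝ) ^ 2 * (m i₀ : ℝ) ^ 2)) := by field_simp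
        _ ≤ (1 / 6) * (1 / ((q i₀ : ℝ) ^ 2 * (m i₀ : ℝ) ^ 2)) := 
            mul_le_mul_of_nonneg_right (by norm_num) (by positivity)
        _ = _ := by field_simp

open Finset in
lemma kim_final (k : ℕ) (m : Fin k → ℕ) [∀ i, NeZero (m i)] (f : Fin k → ℕ → ℤ) (β : ℝ)
    (H : ∀ h : ∀ i, ZMod (m i), h ≠ 0 → ∃ C : ℝ, ∀ N : ℕ, 0 < N →
      ‖∑ n ∈ range N, ∏ i, ZMod.stdAddChar (h i * ((f i n : ℤ) : ZMod (m i)))‖ ≤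
        C * (N : ℝ) ^ β)
    [∀ a : Fin k → ℤ, DecidablePred (fun n => ∀ i, f i n ≡ a i [ZMOD (m i : ℤ)])] :
    ∃ C : ℝ, 0 < C ∧ ∀ a : Fin k → ℤ, ∀ N : ℕ, 0 < N →
      |(((Finset.range N).filter
            (fun n => ∀ i, f i n ≡ a i [ZMOD (m i : ℤ)])).card : ℝ) -
          (N : ℝ) / ∏ i, (m i : ℝ)| ≤ C * (N : ℝ) ^ β := by
  classical
  have H' : ∀ h : ∀ i, ZMod (m i), ∃ C : ℝ, h ≠ 0 → ∀ N : ℕ, 0 < N →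
      ‖∑ n ∈ range N, ∏ i, ZMod.stdAddChar (h i * ((f i n : ℤ) : ZMod (m i)))‖ ≤
        C * (N : ℝ) ^ β := by
    intro h
    by_cases hh : h = 0
    · exact ⟨0, fun h' => absurd hh h'⟩
    · obtain ⟨C, hC⟩ := H h hh
      exact ⟨C, fun _ => hC⟩
  choose C hC using H'
  refine ⟨∑ h, |C h| + 1, by positivity, fun a N hN => ?_⟩
  set cnt := ((Finset.range N).filter (fun n => ∀ i, f i n ≡ a i [ZMOD (m i : ℤ)])).card with hcnt
  set PM : ℝ := ∏ i, (m i : ℝ) with hPM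
  have hm1 : ∀ i, (1 : ℝ) ≤ m i := fun i => by exact_mod_cast NeZero.one_le
  have hPM1 : 1 ≤ PM := by
    calc (1 : ℝ) = ∏ i : Fin k, (1 : ℝ) := by simp
      _ ≤ PM := prod_le_prod (fun _ _ => by norm_num) fun i _ => hm1 i
  have hpt : ∀ n, (if ∀ i, f i n ≡ a i [ZMOD (m i : ℤ)] then ((PM : ℝ) : ℂ) else 0) =
      ∑ h : ∀ i, ZMod (m i), ∏ i, ZMod.stdAddChar (h i * ((f i n - a i : ℤ) : ZMod (m i))) := by
    intro n
    have e1 := (Finset.prod_univ_sum (fun i => (univ : Finset (ZMod (m i))))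
      (fun i x => (ZMod.stdAddChar (x * ((f i n - a i : ℤ) : ZMod (m i))) : ℂ)))
    rw [Fintype.piFinset_univ] at e1
    rw [← e1]
    have e2 : ∀ i, ∑ x : ZMod (m i), (ZMod.stdAddChar (x * ((f i n - a i : ℤ) : ZMod (m i))) : ℂ) =
        if f i n ≡ a i [ZMOD (m i : ℤ)] then (m i : ℂ) else 0 := by
      intro i
      rw [AddChar.sum_mulShift _ (ZMod.isPrimitive_stdAddChar (m i)), ZMod.card]
      have : ((f i n - a i : ℤ) : ZMod (m i)) = 0 ↔ f i n ≡ a i [ZMOD (m i : ℤ)] := by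
        rw [← ZMod.intCast_eq_intCast_iff, Int.cast_sub, sub_eq_zero]
      simp only [this]
      split_ifs <;> simp
    simp only [e2]
    split_ifs with hc
    · rw [prod_congr rfl fun i _ => if_pos (hc i), hPM]; push_cast; rfl
    · push Not at hc
      obtain ⟨i, hi⟩ := hc
      exact (prod_eq_zero (mem_univ i) (if_neg hi)).symm
  have hsum : ((PM * cnt : ℝ) : ℂ) = ∑ h : ∀ i, ZMod (m i),
      (∏ i, ZMod.stdAddChar (-(h i * ((a i : ℤ) : ZMod (m i))))) *
      ∑ n ∈ range N, ∏ i, ZMod.stdAddChar (h i * ((f i n : ℤ) : ZMod (m i))) := by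
    have e1 : ((PM * cnt : ℝ) : ℂ) = ∑ n ∈ range N,
        (if ∀ i, f i n ≡ a i [ZMOD (m i : ℤ)] then ((PM : ℝ) : ℂ) else 0) := by
      rw [← sum_filter, sum_const, nsmul_eq_mul, ← hcnt]; push_cast; ring
    rw [e1, sum_congr rfl fun n _ => hpt n, sum_comm]
    refine sum_congr rfl fun h _ => ?_
    rw [mul_sum]
    refine sum_congr rfl fun n _ => ?_
    rw [← prod_mul_distrib]
    refine prod_congr rfl fun i _ => ?_
    rw [← AddChar.map_add_eq_mul]
    congr 1; push_cast; ring
  rw [← add_sum_erase univ _ (mem_univ (0 : ∀ i, ZMod (m i)))] at hsum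
  have hNβ : 0 ≤ (N : ℝ) ^ β := by positivity
  have hbound : |PM * cnt - N| ≤ (∑ h, |C h|) * (N : ℝ) ^ β := by
    have e2 : ((PM * cnt - N : ℝ) : ℂ) = ∑ h ∈ univ.erase (0 : ∀ i, ZMod (m i)),
        (∏ i, ZMod.stdAddChar (-(h i * ((a i : ℤ) : ZMod (m i))))) *
        ∑ n ∈ range N, ∏ i, ZMod.stdAddChar (h i * ((f i n : ℤ) : ZMod (m i))) := by
      rw [Complex.ofReal_sub, hsum]
      simp
    rw [← Real.norm_eq_abs, ← Complex.norm_real, e2]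
    refine (norm_sum_le _ _).trans ?_
    rw [sum_mul]
    refine (sum_le_sum fun h hh => ?_).trans
      (sum_le_sum_of_subset_of_nonneg (erase_subset _ _) fun h _ _ => by positivity)
    rw [norm_mul, norm_prod]
    have : ∀ i, ‖(ZMod.stdAddChar (-(h i * ((a i : ℤ) : ZMod (m i)))) : ℂ)‖ = 1 := by
      intro i; rw [ZMod.stdAddChar_apply]; exact Circle.norm_coe _
    simp only [this, prod_const_one, one_mul]
    refine (hC h (ne_of_mem_erase hh) N hN).trans ?_
    gcongr
    exact le_abs_self _
  have e3 : (cnt : ℝ) - N / PM = (PM * cnt - N) / PM := by field_simp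
  rw [e3, abs_div, abs_of_pos (by linarith : 0 < PM)]
  refine (div_le_self (abs_nonneg _) hPM1).trans (hbound.trans ?_)
  gcongr
  linarith

open scoped Classical in
/-- **Kim's theorem.** Let `q₁,…,q_k ≥ 2` be pairwise coprime,
`m₁,…,m_k ≥ 2`, and `fᵢ` integer-valued completely `qᵢ`-additive functions.
With `Fᵢ = fᵢ(1)` and `dᵢ = gcd(mᵢ, (qᵢ-1)Fᵢ, fᵢ(r) - r Fᵢ (2 ≤ r ≤ qᵢ-1))`,
assume `gcd(Fᵢ, dᵢ) = 1` and `gcd(dᵢ, dⱼ) = 1` for `i ≠ j`. Then, with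
`δ₁ = 1/(120 k² q³ m²)` where `q = max qᵢ`, `m = max mᵢ`, there is `C > 0` with
`|#{0 ≤ n < N : fᵢ(n) ≡ aᵢ (mod mᵢ) ∀i} - N/(m₁⋯m_k)| ≤ C N^{1-δ₁}`
for all residues `a` and all `N ≥ 1`. -/
theorem stmt_12 (k : ℕ) (hk : 0 < k) (q m : Fin k → ℕ) (f : Fin k → ℕ → ℤ)
    (hq : ∀ i, 2 ≤ q i)
    (hqcop : ∀ i j, i ≠ j → Nat.Coprime (q i) (q j))
    (hm : ∀ i, 2 ≤ m i)
    (hf0 : ∀ i, f i 0 = 0)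
    (hfadd : ∀ i, ∀ a s b : ℕ, 1 ≤ a → 1 ≤ s → b < q i ^ s →
      f i (a * q i ^ s + b) = f i a + f i b)
    (F : Fin k → ℤ) (hF : ∀ i, F i = f i 1)
    (d : Fin k → ℕ)
    (hd : ∀ i, (d i : ℤ) = Int.gcd ((m i : ℤ))
      (Int.gcd (((q i : ℤ) - 1) * F i)
        ((Finset.Icc 2 (q i - 1)).gcd (fun r : ℕ => f i r - (r : ℤ) * F i))))
    (hFd : ∀ i, Int.gcd (F i) ((d i : ℤ)) = 1)
    (hdd : ∀ i j, i ≠ j → Nat.Coprime (d i) (d j)) :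
    ∃ C : ℝ, 0 < C ∧ ∀ a : Fin k → ℤ, ∀ N : ℕ, 0 < N →
      |(((Finset.range N).filter
            (fun n => ∀ i, f i n ≡ a i [ZMOD (m i : ℤ)])).card : ℝ) -
          (N : ℝ) / ∏ i, (m i : ℝ)| ≤
        C * (N : ℝ) ^
          (1 - 1 / (120 * (k : ℝ) ^ 2 * ((Finset.univ.sup q : ℕ) : ℝ) ^ 3 *
            ((Finset.univ.sup m : ℕ) : ℝ) ^ 2)) := by
  have : ∀ i, NeZero (m i) := fun i => ⟨by have := hm i; omega⟩
  exact kim_final k m f _ (fun h hh => kim_expsum k hk q m f hq hqcop hm hf0 hfadd F hF d hd hFd hdd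
    _ rfl h hh)
end
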